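/- Let (V, L) be a quantized metric space and let K^(1) = (K^(1)_k) and K^(2) = (K^(2)_k) be compact matrix convex subsets of CS(V). If (V_j, L_j) is the quotient space of (V, L) with respect to K^(j) and the restriction map φ^(j), for j = 1, 2, then dist_NC(V₁, V₂) ≤ sup_k k⁻² dist_H^{D_{L_k}}(K^(1)_k, K^(2)_k). -/

import Mathlib

open scoped ComplexOrder

noncomputable section

/-- The operator (ℓ² → ℓ²) norm of a complex scalar matrix. -/
noncomputable def scalarOpNorm {m n : Type*} [Fintype m] [Fintype n] [DecidableEq n]
    (γ : Matrix m n ℂ) : ℝ :=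
  ‖LinearMap.toContinuousLinearMap (Matrix.toEuclideanLin γ)‖

/-- A matrix order unit space `(V, 1)`: a complex *-vector space with a distinguished
matrix ordering (given by the graded family of positive cones) and an Archimedean
matrix order unit. -/
structure MOUS : Type 1 where
  carrier : Type
  [acg : AddCommGroup carrier]
  [mod : Module ℂ carrier]
  [sam : StarAddMonoid carrier]
  [sm : StarModule ℂ carrier]
  one : carrier
  pos : ∀ n : ℕ, Set (Matrix (Fin n) (Fin n) carrier)
  pos_add : ∀ n, ∀ v ∈ pos n, ∀ w ∈ pos n, v + w ∈ pos n
  pos_smul : ∀ n (t : ℝ), 0 ≤ t → ∀ v ∈ pos n, (t : ℂ) • v ∈ pos n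
  pos_star : ∀ n, ∀ v ∈ pos n, v.conjTranspose = v
  pos_congr : ∀ n m (γ : Matrix (Fin n) (Fin m) ℂ), ∀ v ∈ pos n,
    (Matrix.of fun i j => ∑ k, ∑ l, (star (γ k i) * γ l j) • v k l) ∈ pos m
  proper : ∀ v : Matrix (Fin 1) (Fin 1) carrier, v ∈ pos 1 → -v ∈ pos 1 → v = 0
  unit_pos : ∀ n, Matrix.diagonal (fun _ => one) ∈ pos n
  orderUnit : ∀ v : carrier, star v = v →
    ∃ t : ℝ, 0 < t ∧
      (Matrix.of fun _ _ => (t : ℂ) • one - v : Matrix (Fin 1) (Fin 1) carrier) ∈ pos 1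
  archimedean : ∀ n (v : Matrix (Fin n) (Fin n) carrier),
    (∀ t : ℝ, 0 < t → v + (t : ℂ) • Matrix.diagonal (fun _ => one) ∈ pos n) → v ∈ pos n

attribute [instance] MOUS.acg MOUS.mod MOUS.sam MOUS.sm

/-- Entrywise application of a linear map to a matrix. -/
def mapMat {V W : Type} [AddCommGroup V] [AddCommGroup W] [Module ℂ V] [Module ℂ W]
    (φ : V →ₗ[ℂ] W) {n : ℕ} (a : Matrix (Fin n) (Fin n) V) : Matrix (Fin n) (Fin n) W :=
  Matrix.of fun i j => φ (a i j)

/-- The direct sum (block diagonal) of two matrices over a vector space. -/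
def dsumMat {V : Type} [AddCommGroup V] {m n : ℕ}
    (v : Matrix (Fin m) (Fin m) V) (w : Matrix (Fin n) (Fin n) V) :
    Matrix (Fin (m + n)) (Fin (m + n)) V :=
  Matrix.reindex finSumFinEquiv finSumFinEquiv (Matrix.fromBlocks v 0 0 w)

/-- The two-sided scalar matrix product `α v β`. -/
def mmulMat {V : Type} [AddCommGroup V] [Module ℂ V] {m n : ℕ}
    (α : Matrix (Fin n) (Fin m) ℂ) (v : Matrix (Fin m) (Fin m) V)
    (β : Matrix (Fin m) (Fin n) ℂ) : Matrix (Fin n) (Fin n) V :=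
  Matrix.of fun i j => ∑ k, ∑ l, (α i k * β l j) • v k l

/-- The unit matrix `1ₙ` in `Mₙ(V)`. -/
def MOUS.unitMat (A : MOUS) (n : ℕ) : Matrix (Fin n) (Fin n) A.carrier :=
  Matrix.diagonal fun _ => A.one

/-- The matrix norm determined by the matrix order:
`‖v‖ = inf { t : [[t1, v], [v*, t1]] ≥ 0 }`. -/
def MOUS.matNorm (A : MOUS) {n : ℕ} (v : Matrix (Fin n) (Fin n) A.carrier) : ℝ :=
  sInf {t : ℝ | (Matrix.reindex finSumFinEquiv finSumFinEquiv
    (Matrix.fromBlocks ((t : ℂ) • A.unitMat n) v v.conjTranspose ((t : ℂ) • A.unitMat n)))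
      ∈ A.pos (n + n)}

/-- A matrix Lipschitz seminorm on a matrix order unit space. -/
structure IsMatrixLipschitzSeminorm (A : MOUS)
    (L : ∀ n : ℕ, Matrix (Fin n) (Fin n) A.carrier → ℝ) : Prop where
  nonneg : ∀ n v, 0 ≤ L n v
  add_le : ∀ n v w, L n (v + w) ≤ L n v + L n w
  smul_eq : ∀ n (c : ℂ) v, L n (c • v) = ‖c‖ * L n v
  null_iff : ∀ n v, L n v = 0 ↔
    ∃ lam : Matrix (Fin n) (Fin n) ℂ, v = Matrix.of fun i j => lam i j • A.one
  dsum_eq : ∀ m n v w, L (m + n) (dsumMat v w) = max (L m v) (L n w)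
  mmul_le : ∀ m n (α : Matrix (Fin n) (Fin m) ℂ) v (β : Matrix (Fin m) (Fin n) ℂ),
    L n (mmulMat α v β) ≤ scalarOpNorm α * L m v * scalarOpNorm β
  star_eq : ∀ n v, L n (Matrix.conjTranspose v) = L n v

/-- A matrix seminorm (finite matrix gauge). -/
structure IsMatrixSeminorm (A : MOUS)
    (N : ∀ n : ℕ, Matrix (Fin n) (Fin n) A.carrier → ℝ) : Prop where
  nonneg : ∀ n v, 0 ≤ N n v
  add_le : ∀ n v w, N n (v + w) ≤ N n v + N n w
  smul_le : ∀ n (c : ℂ) v, N n (c • v) ≤ ‖c‖ * N n v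
  dsum_eq : ∀ m n v w, N (m + n) (dsumMat v w) = max (N m v) (N n w)
  mmul_le : ∀ m n (α : Matrix (Fin n) (Fin m) ℂ) v (β : Matrix (Fin m) (Fin n) ℂ),
    N n (mmulMat α v β) ≤ scalarOpNorm α * N m v * scalarOpNorm β

/-- Linear maps from `V` to `Mₙ(ℂ)`; matrix states live here. -/
abbrev MState (A : MOUS) (n : ℕ) := A.carrier →ₗ[ℂ] Matrix (Fin n) (Fin n) ℂ

/-- The matrix pairing `⟨⟨φ, a⟩⟩ = [φ(a_{ij})] ∈ M_{rn}(ℂ)`. -/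
def mpair {A : MOUS} {n r : ℕ} (φ : MState A n) (a : Matrix (Fin r) (Fin r) A.carrier) :
    Matrix (Fin r × Fin n) (Fin r × Fin n) ℂ :=
  Matrix.of fun p q => φ (a p.1 q.1) p.2 q.2

/-- The `n`-th matrix state space: unital completely positive maps `V → Mₙ(ℂ)`. -/
def CS (A : MOUS) (n : ℕ) : Set (MState A n) :=
  {φ | φ A.one = 1 ∧ ∀ r, ∀ v ∈ A.pos r, (mpair φ v).PosSemidef}

/-- The matrix metric `D_{Lₙ}` on matrix states coming from a matrix Lipschitz seminorm. -/
def Dmet (A : MOUS) (L : ∀ n : ℕ, Matrix (Fin n) (Fin n) A.carrier → ℝ) (n : ℕ)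
    (φ ψ : MState A n) : ℝ :=
  sSup {x | ∃ (r : ℕ) (a : Matrix (Fin r) (Fin r) A.carrier), L r a ≤ 1 ∧
    x = scalarOpNorm (mpair φ a - mpair ψ a)}

/-- The BW (pointwise, weak-*) topology on the space of linear maps `V → Mₙ(ℂ)`. -/
def lmTop (A : MOUS) (n : ℕ) : TopologicalSpace (MState A n) :=
  TopologicalSpace.induced (fun φ => (φ : A.carrier → Matrix (Fin n) (Fin n) ℂ)) inferInstance

/-- The BW topology on the matrix state space. -/
def BWtop (A : MOUS) (n : ℕ) : TopologicalSpace {φ : MState A n // φ ∈ CS A n} :=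
  TopologicalSpace.induced Subtype.val (lmTop A n)

/-- The topology on the matrix state space defined by the matrix metric `D_L`. -/
def Dtop (A : MOUS) (L : ∀ n : ℕ, Matrix (Fin n) (Fin n) A.carrier → ℝ) (n : ℕ) :
    TopologicalSpace {φ : MState A n // φ ∈ CS A n} :=
  TopologicalSpace.generateFrom
    {U | ∃ (φ₀ : {φ : MState A n // φ ∈ CS A n}) (ε : ℝ), 0 < ε ∧
      U = {ψ | Dmet A L n φ₀.1 ψ.1 < ε}}

/-- A matrix Lip-norm: a matrix Lipschitz seminorm for which the `D_L`-topology on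
each matrix state space agrees with the BW-topology. -/
structure IsMatrixLipNorm (A : MOUS)
    (L : ∀ n : ℕ, Matrix (Fin n) (Fin n) A.carrier → ℝ)
    extends IsMatrixLipschitzSeminorm A L : Prop where
  top_eq : ∀ n, Dtop A L n = BWtop A n

/-- A unital completely positive linear map between matrix order unit spaces. -/
structure IsUCP (A B : MOUS) (φ : A.carrier →ₗ[ℂ] B.carrier) : Prop where
  unital : φ A.one = B.one
  cp : ∀ n, ∀ v ∈ A.pos n, mapMat φ v ∈ B.pos n

/-- `L` induces `LB` via the (surjective, UCP) map `φ`: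
`LB` is the corresponding family of quotient seminorms. -/
def Induces (A B : MOUS) (φ : A.carrier →ₗ[ℂ] B.carrier)
    (L : ∀ n : ℕ, Matrix (Fin n) (Fin n) A.carrier → ℝ)
    (LB : ∀ n : ℕ, Matrix (Fin n) (Fin n) B.carrier → ℝ) : Prop :=
  ∀ n (b : Matrix (Fin n) (Fin n) B.carrier),
    LB n b = sInf {x | ∃ a, mapMat φ a = b ∧ x = L n a}

/-- The quotient seminorm of `L` via `φ`. -/
def quotSeminorm (A B : MOUS) (φ : A.carrier →ₗ[ℂ] B.carrier)
    (L : ∀ n : ℕ, Matrix (Fin n) (Fin n) A.carrier → ℝ) (n : ℕ)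
    (b : Matrix (Fin n) (Fin n) B.carrier) : ℝ :=
  sInf {x | ∃ a, mapMat φ a = b ∧ x = L n a}

/-- The operator space (matrix order unit space) direct sum `V₁ ⊕ V₂`. -/
def MOUS.prod (A B : MOUS) : MOUS where
  carrier := A.carrier × B.carrier
  one := (A.one, B.one)
  pos n := {v | (Matrix.of fun i j => (v i j).1) ∈ A.pos n ∧
    (Matrix.of fun i j => (v i j).2) ∈ B.pos n}
  pos_add := by
    rintro n v ⟨hv1, hv2⟩ w ⟨hw1, hw2⟩
    exact ⟨A.pos_add n _ hv1 _ hw1, B.pos_add n _ hv2 _ hw2⟩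
  pos_smul := by
    rintro n t ht v ⟨hv1, hv2⟩
    exact ⟨A.pos_smul n t ht _ hv1, B.pos_smul n t ht _ hv2⟩
  pos_star := by
    rintro n v ⟨hv1, hv2⟩
    have h1 := A.pos_star n _ hv1
    have h2 := B.pos_star n _ hv2
    funext i j
    exact Prod.ext (congrFun (congrFun h1 i) j) (congrFun (congrFun h2 i) j)
  pos_congr := by
    rintro n m γ v ⟨hv1, hv2⟩
    constructor
    · have h1 := A.pos_congr n m γ _ hv1
      convert h1 using 2
      funext i j
      simp [Prod.fst_sum]
    · have h2 := B.pos_congr n m γ _ hv2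
      convert h2 using 2
      funext i j
      simp [Prod.snd_sum]
  proper := by
    rintro v ⟨h1, h2⟩ ⟨h3, h4⟩
    have e1 := A.proper _ h1 h3
    have e2 := B.proper _ h2 h4
    funext i j
    exact Prod.ext (congrFun (congrFun e1 i) j) (congrFun (congrFun e2 i) j)
  unit_pos := by
    intro n
    constructor
    · convert A.unit_pos n using 2
      funext i j
      by_cases hij : i = j <;> simp [Matrix.diagonal_apply, hij]
    · convert B.unit_pos n using 2
      funext i j
      by_cases hij : i = j <;> simp [Matrix.diagonal_apply, hij]
  orderUnit := by
    rintro ⟨a, b⟩ hstar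
    have ha : star a = a := congrArg Prod.fst hstar
    have hb : star b = b := congrArg Prod.snd hstar
    obtain ⟨t₁, ht₁, hp₁⟩ := A.orderUnit a ha
    obtain ⟨t₂, ht₂, hp₂⟩ := B.orderUnit b hb
    have huA : (Matrix.of fun _ _ => A.one : Matrix (Fin 1) (Fin 1) A.carrier) ∈ A.pos 1 := by
      convert A.unit_pos 1 using 2
      funext i j
      simp [Matrix.diagonal_apply, Subsingleton.elim i j]
    have huB : (Matrix.of fun _ _ => B.one : Matrix (Fin 1) (Fin 1) B.carrier) ∈ B.pos 1 := by
      convert B.unit_pos 1 using 2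
      funext i j
      simp [Matrix.diagonal_apply, Subsingleton.elim i j]
    refine ⟨t₁ + t₂, add_pos ht₁ ht₂, ?_, ?_⟩
    · have e : (Matrix.of fun _ _ => ((t₁ + t₂ : ℝ) : ℂ) • A.one - a :
          Matrix (Fin 1) (Fin 1) A.carrier)
          = (Matrix.of fun _ _ => (t₁ : ℂ) • A.one - a) +
            (t₂ : ℂ) • (Matrix.of fun _ _ => A.one) := by
        funext i j
        show ((t₁ + t₂ : ℝ) : ℂ) • A.one - a
          = ((t₁ : ℂ) • A.one - a) + (t₂ : ℂ) • A.one
        push_cast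
        rw [add_smul]
        abel
      exact e ▸ A.pos_add 1 _ hp₁ _ (A.pos_smul 1 t₂ ht₂.le _ huA)
    · have e : (Matrix.of fun _ _ => ((t₁ + t₂ : ℝ) : ℂ) • B.one - b :
          Matrix (Fin 1) (Fin 1) B.carrier)
          = (Matrix.of fun _ _ => (t₂ : ℂ) • B.one - b) +
            (t₁ : ℂ) • (Matrix.of fun _ _ => B.one) := by
        funext i j
        show ((t₁ + t₂ : ℝ) : ℂ) • B.one - b
          = ((t₂ : ℂ) • B.one - b) + (t₁ : ℂ) • B.one
        push_cast
        rw [add_smul]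
        abel
      exact e ▸ B.pos_add 1 _ hp₂ _ (B.pos_smul 1 t₁ ht₁.le _ huB)
  archimedean := by
    rintro n v h
    constructor
    · apply A.archimedean
      intro t ht
      have h1 := (h t ht).1
      have e : (Matrix.of fun i j =>
            (((v + (t : ℂ) • Matrix.diagonal fun _ =>
              ((A.one, B.one) : A.carrier × B.carrier) :
                Matrix (Fin n) (Fin n) (A.carrier × B.carrier))) i j).1)
          = (Matrix.of fun i j => (v i j).1) +
            (t : ℂ) • Matrix.diagonal fun _ => A.one := by
        funext i j
        by_cases hij : i = j <;>
          simp [Matrix.add_apply, Matrix.smul_apply, Matrix.diagonal_apply, hij]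
      rw [e] at h1
      exact h1
    · apply B.archimedean
      intro t ht
      have h2 := (h t ht).2
      have e : (Matrix.of fun i j =>
            (((v + (t : ℂ) • Matrix.diagonal fun _ =>
              ((A.one, B.one) : A.carrier × B.carrier) :
                Matrix (Fin n) (Fin n) (A.carrier × B.carrier))) i j).2)
          = (Matrix.of fun i j => (v i j).2) +
            (t : ℂ) • Matrix.diagonal fun _ => B.one := by
        funext i j
        by_cases hij : i = j <;>
          simp [Matrix.add_apply, Matrix.smul_apply, Matrix.diagonal_apply, hij]
      rw [e] at h2
      exact h2

/-- First coordinate projection `V₁ ⊕ V₂ → V₁`. -/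
def fstL (A B : MOUS) : (A.prod B).carrier →ₗ[ℂ] A.carrier :=
  LinearMap.fst ℂ A.carrier B.carrier

/-- Second coordinate projection `V₁ ⊕ V₂ → V₂`. -/
def sndL (A B : MOUS) : (A.prod B).carrier →ₗ[ℂ] B.carrier :=
  LinearMap.snd ℂ A.carrier B.carrier

/-- `M(L₁, L₂)`: the set of matrix Lip-norms on `V₁ ⊕ V₂` inducing `L₁` and `L₂`
via the coordinate projections. -/
def MSet (A : MOUS) (LA : ∀ n : ℕ, Matrix (Fin n) (Fin n) A.carrier → ℝ)
    (B : MOUS) (LB : ∀ n : ℕ, Matrix (Fin n) (Fin n) B.carrier → ℝ) :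
    Set (∀ n : ℕ, Matrix (Fin n) (Fin n) (A.prod B).carrier → ℝ) :=
  {L | IsMatrixLipNorm (A.prod B) L ∧ Induces (A.prod B) A (fstL A B) L LA ∧
    Induces (A.prod B) B (sndL A B) L LB}

/-- Hausdorff distance between two sets with respect to a distance function. -/
def hDist {X : Type} (d : X → X → ℝ) (s t : Set X) : ℝ :=
  max (sSup ((fun x => sInf ((fun y => d x y) '' t)) '' s))
      (sSup ((fun y => sInf ((fun x => d x y) '' s)) '' t))

/-- The quantized Gromov–Hausdorff distance between two quantized metric spaces. -/
def distNC (A : MOUS) (LA : ∀ n : ℕ, Matrix (Fin n) (Fin n) A.carrier → ℝ)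
    (B : MOUS) (LB : ∀ n : ℕ, Matrix (Fin n) (Fin n) B.carrier → ℝ) : ℝ :=
  sInf {x | ∃ L ∈ MSet A LA B LB, x = ⨆ n : ℕ, ((n : ℝ) ^ 2)⁻¹ *
    hDist (Dmet (A.prod B) L n)
      ((fun φ : MState A n => φ.comp (fstL A B)) '' CS A n)
      ((fun φ : MState B n => φ.comp (sndL A B)) '' CS B n)}

/-- The diameter of a quantized metric space: the diameter of `CS₁(V)` for `D_{L₁}`. -/
def qDiam (A : MOUS) (LA : ∀ n : ℕ, Matrix (Fin n) (Fin n) A.carrier → ℝ) : ℝ :=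
  sSup {x | ∃ φ ∈ CS A 1, ∃ ψ ∈ CS A 1, x = Dmet A LA 1 φ ψ}

/-- Lower semicontinuity of a family of matrix seminorms for the order-unit matrix norms. -/
def IsLSCsem (A : MOUS) (L : ∀ n : ℕ, Matrix (Fin n) (Fin n) A.carrier → ℝ) : Prop :=
  ∀ n (a : Matrix (Fin n) (Fin n) A.carrier) (c : ℝ), c < L n a →
    ∃ δ : ℝ, 0 < δ ∧ ∀ b, A.matNorm (b - a) < δ → c < L n b


/-- The matrix convex combination `Σᵢ γᵢ* φᵢ γᵢ` of matrix states. -/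
def matComb {A : MOUS} {n k : ℕ} {ns : Fin k → ℕ}
    (φ : ∀ i, MState A (ns i)) (γ : ∀ i, Matrix (Fin (ns i)) (Fin n) ℂ) :
    MState A n where
  toFun a := ∑ i, (γ i).conjTranspose * φ i a * γ i
  map_add' := by
    intro a b
    simp only [map_add, Matrix.mul_add, Matrix.add_mul]
    exact Finset.sum_add_distrib
  map_smul' := by
    intro c a
    simp only [map_smul, Matrix.mul_smul, Matrix.smul_mul, RingHom.id_apply]
    exact (Finset.smul_sum).symm

/-- A (graded) matrix convex subset of the matrix state space `CS(V)`. -/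
def IsMatrixConvexSubset (A : MOUS) (K : ∀ n : ℕ, Set (MState A n)) : Prop :=
  (∀ n, K n ⊆ CS A n) ∧
  ∀ (n k : ℕ) (ns : Fin k → ℕ) (φ : ∀ i, MState A (ns i))
    (γ : ∀ i, Matrix (Fin (ns i)) (Fin n) ℂ),
    (∀ i, φ i ∈ K (ns i)) → (∑ i, (γ i).conjTranspose * γ i) = (1 : Matrix (Fin n) (Fin n) ℂ) →
    matComb φ γ ∈ K n

/-- `(W, φ)` is the quotient of the matrix order unit space `V` with respect to the
(compact matrix convex) subset `K` of `CS(V)`: `W` consists of the restrictions to `K`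
of the elements of `V` viewed as matrix affine mappings on `CS(V)`, `φ` being the
restriction mapping.  This is expressed by saying that `φ` is a surjective unital
completely positive map whose kernel and positivity are detected exactly by pairing
against the elements of `K`, and that `K = φᶜ(CS(W))`. -/
structure IsQuotientBy (A : MOUS) (K : ∀ n : ℕ, Set (MState A n)) (W : MOUS)
    (φ : A.carrier →ₗ[ℂ] W.carrier) : Prop where
  ucp : IsUCP A W φ
  surj : Function.Surjective φ
  ker : ∀ (n : ℕ) (a : Matrix (Fin n) (Fin n) A.carrier),
    mapMat φ a = 0 ↔ ∀ r : ℕ, ∀ ψ ∈ K r, mpair ψ a = 0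
  posChar : ∀ (n : ℕ) (a : Matrix (Fin n) (Fin n) A.carrier),
    mapMat φ a ∈ W.pos n ↔ ∀ r : ℕ, ∀ ψ ∈ K r, (mpair ψ a).PosSemidef
  image : ∀ n, K n = (fun ψ : MState W n => ψ.comp φ) '' CS W n

section ScalarOpNorm

variable {l m n : Type*} [Fintype l] [Fintype m] [Fintype n] [DecidableEq n]

open scoped Matrix.Norms.L2Operator in
theorem scalarOpNorm_nonneg (a : Matrix m n ℂ) : 0 ≤ scalarOpNorm a := norm_nonneg _

open scoped Matrix.Norms.L2Operator in
theorem scalarOpNorm_add_le (a b : Matrix m n ℂ) :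
    scalarOpNorm (a + b) ≤ scalarOpNorm a + scalarOpNorm b := norm_add_le a b

open scoped Matrix.Norms.L2Operator in
theorem scalarOpNorm_smul (c : ℂ) (a : Matrix m n ℂ) :
    scalarOpNorm (c • a) = ‖c‖ * scalarOpNorm a := norm_smul c a

open scoped Matrix.Norms.L2Operator in
theorem scalarOpNorm_neg (a : Matrix m n ℂ) : scalarOpNorm (-a) = scalarOpNorm a := norm_neg a

open scoped Matrix.Norms.L2Operator in
theorem scalarOpNorm_zero : scalarOpNorm (0 : Matrix m n ℂ) = 0 :=
  norm_zero (E := Matrix m n ℂ)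

theorem scalarOpNorm_mul_le [DecidableEq m] (a : Matrix l m ℂ) (b : Matrix m n ℂ) :
    scalarOpNorm (a * b) ≤ scalarOpNorm a * scalarOpNorm b :=
  Matrix.l2_opNorm_mul a b

theorem scalarOpNorm_conjTranspose [DecidableEq m] (a : Matrix m n ℂ) :
    scalarOpNorm a.conjTranspose = scalarOpNorm a :=
  Matrix.l2_opNorm_conjTranspose a

open scoped Matrix.Norms.L2Operator in
theorem scalarOpNorm_sum_le {ι : Type*} (s : Finset ι) (f : ι → Matrix m n ℂ) :
    scalarOpNorm (∑ i ∈ s, f i) ≤ ∑ i ∈ s, scalarOpNorm (f i) := norm_sum_le s f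

theorem scalarOpNorm_le {a : Matrix m n ℂ} {C : ℝ} (hC : 0 ≤ C)
    (h : ∀ x : EuclideanSpace ℂ n, ‖WithLp.toLp 2 (a.mulVec x.ofLp)‖ ≤ C * ‖x‖) :
    scalarOpNorm a ≤ C :=
  ContinuousLinearMap.opNorm_le_bound _ hC h

theorem norm_mulVec_le_scalarOpNorm (a : Matrix m n ℂ) (x : EuclideanSpace ℂ n) :
    ‖WithLp.toLp 2 (a.mulVec x.ofLp)‖ ≤ scalarOpNorm a * ‖x‖ :=
  Matrix.l2_opNorm_mulVec a x

theorem scalarOpNorm_one_le : scalarOpNorm (1 : Matrix n n ℂ) ≤ 1 :=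
  scalarOpNorm_le zero_le_one fun x => by simp

theorem scalarOpNorm_le_one_of_conjTranspose_mul_self {a : Matrix m n ℂ}
    (h : a.conjTranspose * a = 1) : scalarOpNorm a ≤ 1 := by
  have h1 : scalarOpNorm (a.conjTranspose * a) = scalarOpNorm a * scalarOpNorm a :=
    Matrix.l2_opNorm_conjTranspose_mul_self a
  rw [h] at h1
  have := scalarOpNorm_one_le (n := n)
  nlinarith [scalarOpNorm_nonneg a]

theorem norm_apply_le_scalarOpNorm (a : Matrix m n ℂ) (i : m) (j : n) :
    ‖a i j‖ ≤ scalarOpNorm a := by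
  have h := norm_mulVec_le_scalarOpNorm a (EuclideanSpace.single j 1)
  have h2 := PiLp.norm_apply_le (WithLp.toLp 2
    (a.mulVec (EuclideanSpace.single j (1 : ℂ)).ofLp) : EuclideanSpace ℂ m) i
  simp at h h2
  exact h2.trans h

theorem scalarOpNorm_col_le {ι : Type*} [Fintype ι] (x : EuclideanSpace ℂ ι) :
    scalarOpNorm (Matrix.of fun i (_ : Fin 1) => x i) ≤ ‖x‖ := by
  refine scalarOpNorm_le (norm_nonneg _) fun y => ?_
  have e : WithLp.toLp 2 ((Matrix.of fun i (_ : Fin 1) => x i).mulVec y.ofLp) = y 0 • x := by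
    ext i
    simp [Matrix.mulVec, dotProduct, mul_comm]
  rw [e, norm_smul, mul_comm]
  gcongr
  exact PiLp.norm_apply_le y 0

/-- A bound for the sesquilinear form of a matrix bounds its operator norm. -/
theorem scalarOpNorm_le_of_compressions {r s : ℕ} {a : Matrix (Fin s) (Fin r) ℂ} {R : ℝ}
    (h : ∀ (α : Matrix (Fin 1) (Fin s) ℂ) (β : Matrix (Fin r) (Fin 1) ℂ),
      scalarOpNorm α ≤ 1 → scalarOpNorm β ≤ 1 → ‖(α * a * β) 0 0‖ ≤ R) :
    scalarOpNorm a ≤ R := by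
  have hR : 0 ≤ R := by simpa using h 0 0 (by simp [scalarOpNorm_zero]) (by simp [scalarOpNorm_zero])
  refine scalarOpNorm_le hR fun x => ?_
  set y : EuclideanSpace ℂ (Fin s) := WithLp.toLp 2 (a.mulVec x.ofLp) with hy
  rcases eq_or_ne y 0 with h0 | h0
  · rw [h0, norm_zero]; positivity
  rcases eq_or_ne x 0 with hx0 | hx0
  · exact absurd (by simp [hy, hx0]) h0
  have hyp : 0 < ‖y‖ := norm_pos_iff.2 h0
  have hxp : 0 < ‖x‖ := norm_pos_iff.2 hx0
  have key := h (((‖y‖⁻¹ : ℝ) : ℂ) • (Matrix.of fun i (_ : Fin 1) => y i).conjTranspose)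
    (((‖x‖⁻¹ : ℝ) : ℂ) • Matrix.of fun i (_ : Fin 1) => x i)
    (by
      rw [scalarOpNorm_smul, scalarOpNorm_conjTranspose]
      calc _ ≤ ‖((‖y‖⁻¹ : ℝ) : ℂ)‖ * ‖y‖ := by gcongr; exact scalarOpNorm_col_le y
        _ = 1 := by simp [hyp.ne'])
    (by
      rw [scalarOpNorm_smul]
      calc _ ≤ ‖((‖x‖⁻¹ : ℝ) : ℂ)‖ * ‖x‖ := by gcongr; exact scalarOpNorm_col_le x
        _ = 1 := by simp [hxp.ne'])
  have e : (((Matrix.of fun i (_ : Fin 1) => y i).conjTranspose * a *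
      Matrix.of fun i (_ : Fin 1) => x i) 0 0) = ((‖y‖ ^ 2 : ℝ) : ℂ) := by
    rw [Matrix.mul_assoc]
    have e2 : ((a * Matrix.of fun i (_ : Fin 1) => x i)) = Matrix.of fun i (_ : Fin 1) => y i := by
      ext i j
      simp [Matrix.mul_apply, hy, Matrix.mulVec, dotProduct]
    rw [e2, EuclideanSpace.norm_sq_eq]
    simp [Matrix.mul_apply, Complex.conj_mul']
  rw [Matrix.smul_mul, Matrix.smul_mul, Matrix.mul_smul, Matrix.smul_apply, Matrix.smul_apply,
    e] at key
  simp only [smul_eq_mul, norm_mul, Complex.norm_real, norm_inv, norm_norm, norm_pow] at key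
  have h3 : ‖y‖⁻¹ * (‖x‖⁻¹ * ‖y‖ ^ 2) = ‖y‖ / ‖x‖ := by field_simp
  rw [h3, div_le_iff₀ hxp] at key
  exact key

theorem scalarOpNorm_dsumMat_le {m n : ℕ} (v : Matrix (Fin m) (Fin m) ℂ)
    (w : Matrix (Fin n) (Fin n) ℂ) :
    scalarOpNorm (dsumMat v w) ≤ max (scalarOpNorm v) (scalarOpNorm w) := by
  have hM : 0 ≤ max (scalarOpNorm v) (scalarOpNorm w) := le_max_of_le_left (scalarOpNorm_nonneg v)
  refine scalarOpNorm_le hM fun x => ?_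
  have h1 := norm_mulVec_le_scalarOpNorm v (WithLp.toLp 2 fun i => x (Fin.castAdd n i))
  have h2 := norm_mulVec_le_scalarOpNorm w (WithLp.toLp 2 fun i => x (Fin.natAdd m i))
  replace h1 := h1.trans (mul_le_mul_of_nonneg_right (le_max_left _ (scalarOpNorm w)) (norm_nonneg _))
  replace h2 := h2.trans (mul_le_mul_of_nonneg_right (le_max_right (scalarOpNorm v) _) (norm_nonneg _))
  have h1' := pow_le_pow_left₀ (norm_nonneg _) h1 2
  have h2' := pow_le_pow_left₀ (norm_nonneg _) h2 2
  rw [mul_pow, EuclideanSpace.norm_sq_eq, EuclideanSpace.norm_sq_eq] at h1' h2'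
  refine le_of_sq_le_sq ?_ (by positivity)
  rw [mul_pow, EuclideanSpace.norm_sq_eq, EuclideanSpace.norm_sq_eq, Fin.sum_univ_add,
    Fin.sum_univ_add, mul_add]
  refine le_trans (le_of_eq ?_) (add_le_add h1' h2')
  congr 1
  · refine Finset.sum_congr rfl fun i _ => ?_
    simp [dsumMat, Matrix.mulVec, dotProduct, Fin.sum_univ_add]
  · refine Finset.sum_congr rfl fun i _ => ?_
    simp [dsumMat, Matrix.mulVec, dotProduct, Fin.sum_univ_add]

end ScalarOpNorm

/-- The matrix pairing is controlled by the entries of compressions of its argument. -/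
theorem scalarOpNorm_mpair_le {A : MOUS} {k r : ℕ} {θ : MState A k}
    {a : Matrix (Fin r) (Fin r) A.carrier} {R : ℝ}
    (h : ∀ (α : Matrix (Fin 1) (Fin r) ℂ) (β : Matrix (Fin r) (Fin 1) ℂ),
      scalarOpNorm α ≤ 1 → scalarOpNorm β ≤ 1 → ∀ i j, ‖θ (mmulMat α a β 0 0) i j‖ ≤ R) :
    scalarOpNorm (mpair θ a) ≤ (k : ℝ) ^ 2 * R := by
  let E : Fin k → Matrix (Fin r × Fin k) (Fin r) ℂ := fun i =>
    Matrix.of fun p q => if p.1 = q ∧ p.2 = i then 1 else 0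
  have hE : ∀ i, scalarOpNorm (E i) ≤ 1 := fun i => by
    refine scalarOpNorm_le_one_of_conjTranspose_mul_self ?_
    ext p q
    simp only [Matrix.mul_apply, Fintype.sum_prod_type, E, Matrix.conjTranspose_apply,
      Matrix.of_apply, Matrix.one_apply]
    simp [ite_and, eq_comm]
  let T : Fin k → Fin k → Matrix (Fin r) (Fin r) ℂ := fun i j =>
    Matrix.of fun p q => θ (a p q) i j
  have hT : ∀ i j, scalarOpNorm (T i j) ≤ R := fun i j => by
    refine scalarOpNorm_le_of_compressions fun α β hα hβ => ?_
    have := h α β hα hβ i j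
    convert this using 2
    simp only [mmulMat, Matrix.of_apply, map_sum, map_smul, Matrix.sum_apply, Matrix.smul_apply,
      Matrix.mul_apply, T, smul_eq_mul, Finset.sum_mul]
    rw [Finset.sum_comm]
    refine Finset.sum_congr rfl fun x _ => Finset.sum_congr rfl fun y _ => ?_
    ring
  have e : mpair θ a = ∑ i, ∑ j, E i * T i j * (E j).conjTranspose := by
    ext p q
    simp only [Matrix.sum_apply, Matrix.mul_apply, E, T, mpair, Matrix.of_apply,
      Matrix.conjTranspose_apply]
    simp [ite_and, apply_ite]
  rw [e]
  calc scalarOpNorm (∑ i, ∑ j, E i * T i j * (E j).conjTranspose)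
      ≤ ∑ i : Fin k, ∑ j : Fin k, scalarOpNorm (E i * T i j * (E j).conjTranspose) :=
        (scalarOpNorm_sum_le _ _).trans (Finset.sum_le_sum fun i _ => scalarOpNorm_sum_le _ _)
    _ ≤ ∑ i : Fin k, ∑ j : Fin k, R := by
        refine Finset.sum_le_sum fun i _ => Finset.sum_le_sum fun j _ => ?_
        have h1 := scalarOpNorm_mul_le (E i * T i j) (E j).conjTranspose
        have h2 := scalarOpNorm_mul_le (E i) (T i j)
        rw [scalarOpNorm_conjTranspose] at h1
        have h3 := scalarOpNorm_nonneg (T i j)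
        have h4 : scalarOpNorm (E i * T i j) ≤ scalarOpNorm (T i j) :=
          h2.trans (mul_le_of_le_one_left h3 (hE i))
        exact (h1.trans (mul_le_of_le_one_right (scalarOpNorm_nonneg _) (hE j))).trans
          (h4.trans (hT i j))
    _ = (k : ℝ) ^ 2 * R := by simp; ring

section OrderUnit

variable {A : MOUS}

theorem MOUS.of_one_mem_pos (A : MOUS) :
    (Matrix.of fun _ _ => A.one : Matrix (Fin 1) (Fin 1) A.carrier) ∈ A.pos 1 := by
  convert A.unit_pos 1 using 2
  ext i j
  simp [Subsingleton.elim i j]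

theorem MOUS.star_eq_of_mem_pos {x : A.carrier}
    (hx : (Matrix.of fun _ _ => x : Matrix (Fin 1) (Fin 1) A.carrier) ∈ A.pos 1) :
    star x = x :=
  congrFun (congrFun (A.pos_star 1 _ hx) 0) 0

theorem MOUS.zero_mem_pos (A : MOUS) (n : ℕ) : (0 : Matrix (Fin n) (Fin n) A.carrier) ∈ A.pos n := by
  simpa using A.pos_smul n 0 le_rfl _ (A.unit_pos n)

theorem MOUS.exists_eq_add_I_smul (a : A.carrier) :
    ∃ h k : A.carrier, star h = h ∧ star k = k ∧ a = h + Complex.I • k := by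
  refine ⟨(1 / 2 : ℂ) • (a + star a), (-Complex.I / 2) • (a - star a), ?_, ?_, ?_⟩
  · rw [star_smul, star_add, star_star, add_comm a]
    congr 1
    simp
  · rw [star_smul, star_sub, star_star, ← neg_sub a, smul_neg, ← neg_smul]
    congr 1
    simp
    ring
  · rw [smul_smul, show Complex.I * (-Complex.I / 2) = (1 / 2 : ℂ) by
      linear_combination (-1 / 2 : ℂ) * Complex.I_mul_I]
    rw [← smul_add, show a + star a + (a - star a) = (2 : ℂ) • a by rw [two_smul]; abel, smul_smul]
    norm_num

/-- A linear map that sends positive elements to self-adjoint ones preserves the involution. -/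
theorem MOUS.map_star_of_pos {E : Type*} [AddCommGroup E] [Module ℂ E] [StarAddMonoid E]
    [StarModule ℂ E] (f : A.carrier →ₗ[ℂ] E)
    (hf : ∀ x, (Matrix.of fun _ _ => x : Matrix (Fin 1) (Fin 1) A.carrier) ∈ A.pos 1 →
      star (f x) = f x) (a : A.carrier) : f (star a) = star (f a) := by
  have key : ∀ h : A.carrier, star h = h → star (f h) = f h := fun h hh => by
    obtain ⟨t, -, ht⟩ := A.orderUnit h hh
    have h1 := hf _ ht
    have h2 := hf _ A.of_one_mem_pos
    rw [map_sub, map_smul, star_sub, star_smul, h2] at h1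
    simpa using h1
  obtain ⟨h, k, hh, hk, rfl⟩ := MOUS.exists_eq_add_I_smul a
  rw [star_add, star_smul, hh, hk, map_add, map_add, star_add, map_smul, map_smul, star_smul,
    key h hh, key k hk]

theorem IsUCP.map_star {B : MOUS} {φ : A.carrier →ₗ[ℂ] B.carrier} (h : IsUCP A B φ)
    (a : A.carrier) : φ (star a) = star (φ a) :=
  MOUS.map_star_of_pos φ (fun _ hx => MOUS.star_eq_of_mem_pos (h.cp 1 _ hx)) a

/-- Complete positivity of a linear map into scalar matrices. -/
def MState.IsCP {n : ℕ} (θ : MState A n) : Prop :=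
  ∀ r, ∀ v ∈ A.pos r, (mpair θ v).PosSemidef

theorem MState.IsCP.apply_nonneg {θ : MState A 1} (hθ : θ.IsCP) {x : A.carrier}
    (hx : (Matrix.of fun _ _ => x : Matrix (Fin 1) (Fin 1) A.carrier) ∈ A.pos 1) :
    0 ≤ θ x 0 0 :=
  (hθ 1 _ hx).diag_nonneg (i := (0, 0))

theorem MState.IsCP.map_star {θ : MState A 1} (hθ : θ.IsCP) (a : A.carrier) :
    θ (star a) 0 0 = star (θ a 0 0) :=
  MOUS.map_star_of_pos ((Matrix.entryLinearMap ℂ ℂ 0 0).comp θ)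
    (fun x hx => by
      have := hθ.apply_nonneg hx
      exact Complex.conj_eq_iff_im.2 (Complex.nonneg_iff.1 this).2.symm) a

/-- Completely positive functionals are bounded on each element by their value at the unit. -/
theorem MState.IsCP.exists_bound (b : A.carrier) :
    ∃ C : ℝ, 0 ≤ C ∧ ∀ θ : MState A 1, θ.IsCP → ‖θ b 0 0‖ ≤ C * (θ A.one 0 0).re := by
  have key : ∀ h : A.carrier, star h = h →
      ∃ C : ℝ, 0 ≤ C ∧ ∀ θ : MState A 1, θ.IsCP → ‖θ h 0 0‖ ≤ C * (θ A.one 0 0).re := by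
    intro h hh
    obtain ⟨s, hs, hs'⟩ := A.orderUnit h hh
    obtain ⟨t, ht, ht'⟩ := A.orderUnit (-h) (by rw [star_neg, hh])
    refine ⟨s + t, by positivity, fun θ hθ => ?_⟩
    have h1 := Complex.nonneg_iff.1 (hθ.apply_nonneg hs')
    have h2 := Complex.nonneg_iff.1 (hθ.apply_nonneg ht')
    have h3 := Complex.nonneg_iff.1 (hθ.apply_nonneg A.of_one_mem_pos)
    simp only [map_sub, map_smul, map_neg, Matrix.sub_apply, Matrix.smul_apply, Matrix.neg_apply,
      smul_eq_mul, Complex.sub_re, Complex.sub_im, Complex.re_ofReal_mul, Complex.im_ofReal_mul,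
      Complex.neg_re, Complex.neg_im] at h1 h2
    have him : (θ h 0 0).im = 0 := by
      have := h1.2
      rw [← h3.2] at this
      linarith
    rw [← Complex.re_add_im (θ h 0 0), him]
    simp only [Complex.ofReal_zero, zero_mul, add_zero, Complex.norm_real, Real.norm_eq_abs]
    rw [abs_le]
    constructor <;> nlinarith [h1.1, h2.1, h3.1]
  obtain ⟨h, k, hh, hk, rfl⟩ := MOUS.exists_eq_add_I_smul b
  obtain ⟨C, hC, hC'⟩ := key h hh
  obtain ⟨D, hD, hD'⟩ := key k hk
  refine ⟨C + D, by positivity, fun θ hθ => ?_⟩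
  rw [map_add, map_smul, Matrix.add_apply, Matrix.smul_apply, add_mul]
  refine (norm_add_le _ _).trans (add_le_add (hC' θ hθ) ?_)
  simpa using hD' θ hθ

theorem MState.apply_one_of_mem_CS {μ : MState A 1} (hμ : μ ∈ CS A 1) : μ A.one 0 0 = 1 := by
  rw [hμ.1]; simp

/-- A bound over all states controls every completely positive functional. -/
theorem MState.IsCP.norm_apply_le {b : A.carrier} {R : ℝ}
    (hR : ∀ μ ∈ CS A 1, ‖μ b 0 0‖ ≤ R) {θ : MState A 1} (hθ : θ.IsCP) :
    ‖θ b 0 0‖ ≤ (θ A.one 0 0).re * R := by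
  have h3 := Complex.nonneg_iff.1 (hθ.apply_nonneg A.of_one_mem_pos)
  rcases h3.1.eq_or_lt with h0 | h0
  · obtain ⟨C, -, hC⟩ := MState.IsCP.exists_bound b
    have := hC θ hθ
    rw [← h0] at this ⊢
    simpa using this
  set t := (θ A.one 0 0).re with ht
  have ht' : θ A.one 0 0 = (t : ℂ) := by
    rw [← Complex.re_add_im (θ A.one 0 0), ← h3.2]; simp [ht]
  have hmem : ((t⁻¹ : ℝ) : ℂ) • θ ∈ CS A 1 := by
    refine ⟨?_, fun r v hv => ?_⟩
    · ext i j
      rw [Subsingleton.elim i 0, Subsingleton.elim j 0]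
      simp only [LinearMap.smul_apply, Matrix.smul_apply, ht', smul_eq_mul]
      rw [← Complex.ofReal_mul, inv_mul_cancel₀ h0.ne']
      simp
    · have : mpair (((t⁻¹ : ℝ) : ℂ) • θ) v = ((t⁻¹ : ℝ) : ℂ) • mpair θ v := by
        ext p q; simp [mpair]
      rw [this]
      exact (hθ r v hv).smul (by rw [Complex.zero_le_real]; positivity)
  have := hR _ hmem
  rw [LinearMap.smul_apply, Matrix.smul_apply, smul_eq_mul, norm_mul, Complex.norm_real,
    Real.norm_eq_abs, abs_of_pos (inv_pos.2 h0), inv_mul_le_iff₀ h0] at this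
  exact this

/-- The functional `γ* χ γ`. -/
def MState.compress {k : ℕ} (χ : MState A k) (γ : Matrix (Fin k) (Fin 1) ℂ) : MState A 1 where
  toFun a := γ.conjTranspose * χ a * γ
  map_add' a b := by simp only [map_add, Matrix.mul_add, Matrix.add_mul]
  map_smul' c a := by simp only [map_smul, Matrix.mul_smul, Matrix.smul_mul, RingHom.id_apply]

theorem MState.IsCP.compress {k : ℕ} {χ : MState A k} (hχ : χ.IsCP)
    (γ : Matrix (Fin k) (Fin 1) ℂ) : (χ.compress γ).IsCP := fun r v hv => by
  let G : Matrix (Fin r × Fin k) (Fin r × Fin 1) ℂ :=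
    Matrix.of fun p q => if p.1 = q.1 then γ p.2 q.2 else 0
  have : mpair (χ.compress γ) v = G.conjTranspose * mpair χ v * G := by
    ext p q
    simp [mpair, MState.compress, Matrix.mul_apply, G, Fintype.sum_prod_type, apply_ite]
  rw [this]
  exact (hχ r v hv).conjTranspose_mul_mul_same G

/-- A bound over all states controls the entries of every matrix state. -/
theorem norm_matrixState_apply_le {b : A.carrier} {R : ℝ}
    (hR : ∀ μ ∈ CS A 1, ‖μ b 0 0‖ ≤ R) {k : ℕ} {χ : MState A k} (hχ : χ ∈ CS A k)
    (i j : Fin k) : ‖χ b i j‖ ≤ 2 * R := by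
  let P : Fin k → Matrix (Fin k) (Fin 1) ℂ := fun l => Matrix.single l 0 1
  have hP : ∀ (X : Matrix (Fin k) (Fin k) ℂ) (l m : Fin k),
      ((P l).conjTranspose * X * P m) 0 0 = X l m := fun X l m => by
    simp [P, Matrix.mul_apply, Matrix.single_apply]
  let γ : ℂ → Matrix (Fin k) (Fin 1) ℂ := fun ω => P j + ω • P i
  have hq : ∀ a ω, (χ.compress (γ ω)) a 0 0 =
      χ a j j + star ω * ω * χ a i i + ω * χ a j i + star ω * χ a i j := fun a ω => by
    have : (χ.compress (γ ω)) a 0 0 = ((γ ω).conjTranspose * χ a * γ ω) 0 0 := rfl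
    simp only [this, γ, Matrix.conjTranspose_add, Matrix.conjTranspose_smul, Matrix.add_mul,
      Matrix.mul_add, Matrix.smul_mul, Matrix.mul_smul, Matrix.add_apply, Matrix.smul_apply, hP,
      smul_eq_mul]
    ring
  have hb : ∀ ω, ‖(χ.compress (γ ω)) b 0 0‖ ≤ ((χ.compress (γ ω)) A.one 0 0).re * R := fun ω =>
    MState.IsCP.norm_apply_le hR (MState.IsCP.compress hχ.2 _)
  have e : 4 * χ b i j = (χ.compress (γ 1)) b 0 0 - (χ.compress (γ (-1))) b 0 0
      + Complex.I * (χ.compress (γ Complex.I)) b 0 0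
      - Complex.I * (χ.compress (γ (-Complex.I))) b 0 0 := by
    simp only [hq, star_one, star_neg, Complex.star_def, Complex.conj_I]
    linear_combination (2 * χ b i j - 2 * χ b j i) * Complex.I_mul_I
  have e1 : ((χ.compress (γ 1)) A.one 0 0).re + ((χ.compress (γ (-1))) A.one 0 0).re +
      ((χ.compress (γ Complex.I)) A.one 0 0).re +
      ((χ.compress (γ (-Complex.I))) A.one 0 0).re = 8 := by
    simp only [hq, hχ.1, ← Complex.add_re]
    simp only [star_one, star_neg, Complex.star_def, Complex.conj_I, Matrix.one_apply_eq]
    have : ∀ z w : ℂ, (1 + 1 * 1 * 1 + 1 * z + 1 * w + (1 + -1 * -1 * 1 + -1 * z + -1 * w) +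
      (1 + -Complex.I * Complex.I * 1 + Complex.I * z + -Complex.I * w) +
      (1 + - -Complex.I * -Complex.I * 1 + -Complex.I * z + - -Complex.I * w)) = (8 : ℂ) := by
      intro z w
      linear_combination -2 * Complex.I_mul_I
    rw [this]
    simp
  have h4 : ‖4 * χ b i j‖ ≤ 8 * R := by
    rw [e, ← e1, add_mul, add_mul, add_mul]
    refine (norm_sub_le _ _).trans (add_le_add ((norm_add_le _ _).trans (add_le_add
      ((norm_sub_le _ _).trans (add_le_add (hb _) (hb _))) ?_)) ?_)
    · simpa using hb Complex.I
    · simpa using hb (-Complex.I)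
  rw [norm_mul] at h4
  norm_num at h4
  linarith

theorem norm_sub_matrixState_apply_le {b : A.carrier} {R : ℝ} {c : ℂ}
    (hR : ∀ μ ∈ CS A 1, ‖μ b 0 0 - c‖ ≤ R) {k : ℕ} {χ χ' : MState A k} (hχ : χ ∈ CS A k)
    (hχ' : χ' ∈ CS A k) (i j : Fin k) : ‖(χ - χ') b i j‖ ≤ 4 * R := by
  have hR' : ∀ μ ∈ CS A 1, ‖μ (b - c • A.one) 0 0‖ ≤ R := fun μ hμ => by
    simpa [map_sub, MState.apply_one_of_mem_CS hμ] using hR μ hμ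
  have h1 := norm_matrixState_apply_le hR' hχ i j
  have h2 := norm_matrixState_apply_le hR' hχ' i j
  have e : (χ - χ') b i j = χ (b - c • A.one) i j - χ' (b - c • A.one) i j := by
    simp [map_sub, hχ.1, hχ'.1]
  rw [e]
  linarith [norm_sub_le (χ (b - c • A.one) i j) (χ' (b - c • A.one) i j)]

end OrderUnit

section MapMat

variable {V W : Type} [AddCommGroup V] [AddCommGroup W] [Module ℂ V] [Module ℂ W]
  (f : V →ₗ[ℂ] W)

theorem mapMat_add {n : ℕ} (v w : Matrix (Fin n) (Fin n) V) :
    mapMat f (v + w) = mapMat f v + mapMat f w := by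
  ext i j; simp [mapMat]

theorem mapMat_sub {n : ℕ} (v w : Matrix (Fin n) (Fin n) V) :
    mapMat f (v - w) = mapMat f v - mapMat f w := by
  ext i j; simp [mapMat]

theorem mapMat_smul {n : ℕ} (c : ℂ) (v : Matrix (Fin n) (Fin n) V) :
    mapMat f (c • v) = c • mapMat f v := by
  ext i j; simp [mapMat]

theorem mapMat_dsumMat {m n : ℕ} (v : Matrix (Fin m) (Fin m) V) (w : Matrix (Fin n) (Fin n) V) :
    mapMat f (dsumMat v w) = dsumMat (mapMat f v) (mapMat f w) := by
  ext i j
  refine Fin.addCases (fun i => ?_) (fun i => ?_) i <;>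
    refine Fin.addCases (fun j => ?_) (fun j => ?_) j <;> simp [mapMat, dsumMat]

theorem mapMat_mmulMat {m n : ℕ} (α : Matrix (Fin n) (Fin m) ℂ) (v : Matrix (Fin m) (Fin m) V)
    (β : Matrix (Fin m) (Fin n) ℂ) :
    mapMat f (mmulMat α v β) = mmulMat α (mapMat f v) β := by
  ext i j; simp [mapMat, mmulMat]

theorem mapMat_surjective (hf : Function.Surjective f) (n : ℕ) :
    Function.Surjective (mapMat f : Matrix (Fin n) (Fin n) V → Matrix (Fin n) (Fin n) W) := by
  intro b
  choose g hg using hf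
  exact ⟨Matrix.of fun i j => g (b i j), by ext i j; simp [mapMat, hg]⟩

theorem mapMat_conjTranspose [StarAddMonoid V] [StarAddMonoid W]
    (hf : ∀ a, f (star a) = star (f a)) {n : ℕ} (v : Matrix (Fin n) (Fin n) V) :
    mapMat f v.conjTranspose = (mapMat f v).conjTranspose := by
  ext i j; simp [mapMat, hf]

theorem exists_mmulMat_dsumMat_left {m n : ℕ} :
    ∃ (α : Matrix (Fin m) (Fin (m + n)) ℂ) (β : Matrix (Fin (m + n)) (Fin m) ℂ),
      scalarOpNorm α ≤ 1 ∧ scalarOpNorm β ≤ 1 ∧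
      ∀ (v : Matrix (Fin m) (Fin m) V) (w : Matrix (Fin n) (Fin n) V),
        mmulMat α (dsumMat v w) β = v := by
  let β : Matrix (Fin (m + n)) (Fin m) ℂ := Matrix.of fun k i => if k = Fin.castAdd n i then 1 else 0
  have hβ : scalarOpNorm β ≤ 1 := scalarOpNorm_le_one_of_conjTranspose_mul_self (by
    ext i j; simp [β, Matrix.mul_apply, Matrix.one_apply, eq_comm])
  refine ⟨β.conjTranspose, β, by rwa [scalarOpNorm_conjTranspose], hβ, fun v w => ?_⟩
  ext i j
  simp [mmulMat, β, dsumMat, apply_ite, ite_smul]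

theorem exists_mmulMat_dsumMat_right {m n : ℕ} :
    ∃ (α : Matrix (Fin n) (Fin (m + n)) ℂ) (β : Matrix (Fin (m + n)) (Fin n) ℂ),
      scalarOpNorm α ≤ 1 ∧ scalarOpNorm β ≤ 1 ∧
      ∀ (v : Matrix (Fin m) (Fin m) V) (w : Matrix (Fin n) (Fin n) V),
        mmulMat α (dsumMat v w) β = w := by
  let β : Matrix (Fin (m + n)) (Fin n) ℂ := Matrix.of fun k i => if k = Fin.natAdd m i then 1 else 0
  have hβ : scalarOpNorm β ≤ 1 := scalarOpNorm_le_one_of_conjTranspose_mul_self (by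
    ext i j; simp [β, Matrix.mul_apply, Matrix.one_apply, eq_comm])
  refine ⟨β.conjTranspose, β, by rwa [scalarOpNorm_conjTranspose], hβ, fun v w => ?_⟩
  ext i j
  simp [mmulMat, β, dsumMat, apply_ite, ite_smul]

end MapMat

section Seminorm

variable {P Q : MOUS} {M N : ∀ n : ℕ, Matrix (Fin n) (Fin n) P.carrier → ℝ}

theorem IsMatrixSeminorm.of_dsum_le (nonneg : ∀ n v, 0 ≤ M n v)
    (add_le : ∀ n v w, M n (v + w) ≤ M n v + M n w)
    (smul_le : ∀ n (c : ℂ) v, M n (c • v) ≤ ‖c‖ * M n v)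
    (dsum_le : ∀ m n v w, M (m + n) (dsumMat v w) ≤ max (M m v) (M n w))
    (mmul_le : ∀ m n (α : Matrix (Fin n) (Fin m) ℂ) v (β : Matrix (Fin m) (Fin n) ℂ),
      M n (mmulMat α v β) ≤ scalarOpNorm α * M m v * scalarOpNorm β) :
    IsMatrixSeminorm P M where
  nonneg := nonneg
  add_le := add_le
  smul_le := smul_le
  mmul_le := mmul_le
  dsum_eq m n v w := by
    refine le_antisymm (dsum_le m n v w) (max_le ?_ ?_)
    · obtain ⟨α, β, hα, hβ, h⟩ := exists_mmulMat_dsumMat_left (V := P.carrier) (m := m) (n := n)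
      have := mmul_le _ _ α (dsumMat v w) β
      rw [h] at this
      exact this.trans ((mul_le_of_le_one_right (mul_nonneg (scalarOpNorm_nonneg _) (nonneg _ _))
        hβ).trans (mul_le_of_le_one_left (nonneg _ _) hα))
    · obtain ⟨α, β, hα, hβ, h⟩ := exists_mmulMat_dsumMat_right (V := P.carrier) (m := m) (n := n)
      have := mmul_le _ _ α (dsumMat v w) β
      rw [h] at this
      exact this.trans ((mul_le_of_le_one_right (mul_nonneg (scalarOpNorm_nonneg _) (nonneg _ _))
        hβ).trans (mul_le_of_le_one_left (nonneg _ _) hα))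

theorem IsMatrixLipschitzSeminorm.isMatrixSeminorm (h : IsMatrixLipschitzSeminorm P M) :
    IsMatrixSeminorm P M :=
  ⟨h.nonneg, h.add_le, fun n c v => (h.smul_eq n c v).le, h.dsum_eq, h.mmul_le⟩

theorem IsMatrixSeminorm.map_zero (h : IsMatrixSeminorm P M) (n : ℕ) : M n 0 = 0 := by
  refine le_antisymm ?_ (h.nonneg _ _)
  simpa using h.smul_le n 0 0

theorem IsMatrixSeminorm.smul_eq (h : IsMatrixSeminorm P M) (n : ℕ) (c : ℂ)
    (v : Matrix (Fin n) (Fin n) P.carrier) : M n (c • v) = ‖c‖ * M n v := by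
  refine le_antisymm (h.smul_le n c v) ?_
  rcases eq_or_ne c 0 with rfl | hc
  · simpa using h.nonneg _ _
  have := h.smul_le n c⁻¹ (c • v)
  rwa [smul_smul, inv_mul_cancel₀ hc, one_smul, norm_inv, ← div_eq_inv_mul,
    le_div_iff₀' (norm_pos_iff.2 hc)] at this

theorem IsMatrixSeminorm.comap {M : ∀ n : ℕ, Matrix (Fin n) (Fin n) Q.carrier → ℝ}
    (h : IsMatrixSeminorm Q M) (f : P.carrier →ₗ[ℂ] Q.carrier) :
    IsMatrixSeminorm P fun n v => M n (mapMat f v) where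
  nonneg n v := h.nonneg _ _
  add_le n v w := by rw [mapMat_add]; exact h.add_le _ _ _
  smul_le n c v := by rw [mapMat_smul]; exact h.smul_le _ _ _
  dsum_eq m n v w := by rw [mapMat_dsumMat]; exact h.dsum_eq _ _ _ _
  mmul_le m n α v β := by rw [mapMat_mmulMat]; exact h.mmul_le _ _ _ _ _

theorem IsMatrixSeminorm.sup (hM : IsMatrixSeminorm P M) (hN : IsMatrixSeminorm P N) :
    IsMatrixSeminorm P fun n v => max (M n v) (N n v) where
  nonneg n v := le_max_of_le_left (hM.nonneg _ _)
  add_le n v w := max_le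
    ((hM.add_le n v w).trans (add_le_add (le_max_left _ _) (le_max_left _ _)))
    ((hN.add_le n v w).trans (add_le_add (le_max_right _ _) (le_max_right _ _)))
  smul_le n c v := max_le
    ((hM.smul_le n c v).trans (by gcongr; exact le_max_left _ _))
    ((hN.smul_le n c v).trans (by gcongr; exact le_max_right _ _))
  dsum_eq m n v w := by rw [hM.dsum_eq, hN.dsum_eq]; exact max_max_max_comm _ _ _ _
  mmul_le m n α v β := max_le
    ((hM.mmul_le m n α v β).trans (mul_le_mul_of_nonneg_right
      (mul_le_mul_of_nonneg_left (le_max_left _ _) (scalarOpNorm_nonneg _)) (scalarOpNorm_nonneg _)))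
    ((hN.mmul_le m n α v β).trans (mul_le_mul_of_nonneg_right
      (mul_le_mul_of_nonneg_left (le_max_right _ _) (scalarOpNorm_nonneg _))
      (scalarOpNorm_nonneg _)))

theorem IsMatrixSeminorm.const_mul (hM : IsMatrixSeminorm P M) {c : ℝ} (hc : 0 ≤ c) :
    IsMatrixSeminorm P fun n v => c * M n v where
  nonneg n v := mul_nonneg hc (hM.nonneg _ _)
  add_le n v w := by rw [← mul_add]; exact mul_le_mul_of_nonneg_left (hM.add_le _ _ _) hc
  smul_le n z v := by
    rw [mul_left_comm]; exact mul_le_mul_of_nonneg_left (hM.smul_le _ _ _) hc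
  dsum_eq m n v w := by rw [hM.dsum_eq, mul_max_of_nonneg _ _ hc]
  mmul_le m n α v β := by
    rw [mul_left_comm, mul_assoc c]
    exact mul_le_mul_of_nonneg_left (hM.mmul_le _ _ _ _ _) hc

theorem quotSeminorm_mapMat_le (hM : ∀ n v, 0 ≤ M n v) (f : P.carrier →ₗ[ℂ] Q.carrier) {n : ℕ}
    (a : Matrix (Fin n) (Fin n) P.carrier) : quotSeminorm P Q f M n (mapMat f a) ≤ M n a :=
  csInf_le ⟨0, by rintro x ⟨a, -, rfl⟩; exact hM _ _⟩ ⟨a, rfl, rfl⟩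

theorem exists_lt_of_quotSeminorm_lt {f : P.carrier →ₗ[ℂ] Q.carrier} (hf : Function.Surjective f)
    {n : ℕ} {b : Matrix (Fin n) (Fin n) Q.carrier} {c : ℝ} (h : quotSeminorm P Q f M n b < c) :
    ∃ a, mapMat f a = b ∧ M n a < c := by
  obtain ⟨a, ha⟩ := mapMat_surjective f hf n b
  obtain ⟨x, ⟨a, ha, rfl⟩, hx⟩ := exists_lt_of_csInf_lt
    (s := {x | ∃ a, mapMat f a = b ∧ x = M n a}) ⟨M n a, a, ha, rfl⟩ h
  exact ⟨a, ha, hx⟩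

theorem quotSeminorm_nonneg (hM : ∀ n v, 0 ≤ M n v) (f : P.carrier →ₗ[ℂ] Q.carrier) {n : ℕ}
    (b : Matrix (Fin n) (Fin n) Q.carrier) : 0 ≤ quotSeminorm P Q f M n b :=
  Real.sInf_nonneg (by rintro x ⟨a, -, rfl⟩; exact hM _ _)

theorem le_mul_of_forall_pos_add {x y c : ℝ} (hc : 0 ≤ c) (h : ∀ δ > 0, x ≤ c * (y + δ)) :
    x ≤ c * y := by
  refine le_of_forall_pos_le_add fun ε hε => ?_
  have h1 := h (ε / (c + 1)) (by positivity)
  have h2 : c * (ε / (c + 1)) ≤ ε := by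
    rw [← mul_div_assoc, div_le_iff₀ (by positivity)]
    nlinarith
  linarith [mul_add c y (ε / (c + 1))]

theorem IsMatrixSeminorm.quotient (hM : IsMatrixSeminorm P M) {f : P.carrier →ₗ[ℂ] Q.carrier}
    (hf : Function.Surjective f) : IsMatrixSeminorm Q (quotSeminorm P Q f M) := by
  have lift : ∀ {n : ℕ} (b : Matrix (Fin n) (Fin n) Q.carrier) (δ : ℝ), 0 < δ →
      ∃ a, mapMat f a = b ∧ M n a < quotSeminorm P Q f M n b + δ := fun b δ hδ =>
    exists_lt_of_quotSeminorm_lt hf (lt_add_of_pos_right _ hδ)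
  refine IsMatrixSeminorm.of_dsum_le (fun n v => quotSeminorm_nonneg hM.nonneg f v)
    (fun n v w => ?_) (fun n c v => ?_) (fun m n v w => ?_) (fun m n α v β => ?_)
  · refine le_of_forall_pos_le_add fun δ hδ => ?_
    obtain ⟨a, rfl, ha'⟩ := lift v (δ / 2) (by positivity)
    obtain ⟨b, rfl, hb'⟩ := lift w (δ / 2) (by positivity)
    have := quotSeminorm_mapMat_le hM.nonneg f (a + b)
    rw [mapMat_add] at this
    linarith [hM.add_le n a b]
  · refine le_mul_of_forall_pos_add (norm_nonneg c) fun δ hδ => ?_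
    obtain ⟨a, rfl, ha'⟩ := lift v δ hδ
    have := quotSeminorm_mapMat_le hM.nonneg f (c • a)
    rw [mapMat_smul] at this
    exact this.trans ((hM.smul_le n c a).trans (by gcongr))
  · refine le_of_forall_pos_le_add fun δ hδ => ?_
    obtain ⟨a, rfl, ha'⟩ := lift v δ hδ
    obtain ⟨b, rfl, hb'⟩ := lift w δ hδ
    have := quotSeminorm_mapMat_le hM.nonneg f (dsumMat a b)
    rw [mapMat_dsumMat, hM.dsum_eq] at this
    refine this.trans ?_
    rw [← max_add_add_right]
    exact max_le_max ha'.le hb'.le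
  · rw [mul_right_comm]
    refine le_mul_of_forall_pos_add (mul_nonneg (scalarOpNorm_nonneg _) (scalarOpNorm_nonneg _))
      fun δ hδ => ?_
    obtain ⟨a, rfl, ha'⟩ := lift v δ hδ
    have := quotSeminorm_mapMat_le hM.nonneg f (mmulMat α a β)
    rw [mapMat_mmulMat] at this
    refine this.trans ((hM.mmul_le m n α a β).trans ?_)
    rw [mul_right_comm]
    exact mul_le_mul_of_nonneg_left ha'.le
      (mul_nonneg (scalarOpNorm_nonneg _) (scalarOpNorm_nonneg _))

theorem quotSeminorm_conjTranspose (hM : ∀ n v, 0 ≤ M n v)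
    (hstar : ∀ n v, M n (Matrix.conjTranspose v) = M n v) {f : P.carrier →ₗ[ℂ] Q.carrier}
    (hf : Function.Surjective f) (hfs : ∀ a, f (star a) = star (f a)) {n : ℕ}
    (b : Matrix (Fin n) (Fin n) Q.carrier) :
    quotSeminorm P Q f M n b.conjTranspose = quotSeminorm P Q f M n b := by
  have key : ∀ b : Matrix (Fin n) (Fin n) Q.carrier,
      quotSeminorm P Q f M n b.conjTranspose ≤ quotSeminorm P Q f M n b := fun b => by
    refine le_of_forall_pos_le_add fun δ hδ => ?_
    obtain ⟨a, rfl, ha⟩ := exists_lt_of_quotSeminorm_lt (M := M) hf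
      (lt_add_of_pos_right (quotSeminorm P Q f M n b) hδ)
    rw [← mapMat_conjTranspose f hfs]
    exact (quotSeminorm_mapMat_le hM f _).trans ((hstar n a).le.trans ha.le)
  refine le_antisymm (key b) ?_
  simpa using key b.conjTranspose

end Seminorm

section StateNorm

variable {A : MOUS}

/-- The matrix seminorm `sup_{μ ∈ X} ‖[μ(a_{ij})]‖` attached to a set `X` of states. -/
def stateSeminorm (A : MOUS) (X : Set (MState A 1)) (n : ℕ)
    (a : Matrix (Fin n) (Fin n) A.carrier) : ℝ :=
  ⨆ μ : X, scalarOpNorm (Matrix.of fun i j => μ.1 (a i j) 0 0)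

variable {X : Set (MState A 1)}

theorem stateSeminorm_bddAbove (hX : X ⊆ CS A 1) {n : ℕ} (a : Matrix (Fin n) (Fin n) A.carrier) :
    BddAbove (Set.range fun μ : X => scalarOpNorm (Matrix.of fun i j => μ.1 (a i j) 0 0)) := by
  choose C hC hC' using fun i j => MState.IsCP.exists_bound (a i j)
  refine ⟨∑ i, ∑ j, C i j, ?_⟩
  rintro _ ⟨μ, rfl⟩
  have hμ := hX μ.2
  refine scalarOpNorm_le_of_compressions fun α β hα hβ => ?_
  simp only [Matrix.mul_apply, Matrix.of_apply, Finset.sum_mul]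
  rw [Finset.sum_comm]
  refine (norm_sum_le _ _).trans (Finset.sum_le_sum fun i _ => (norm_sum_le _ _).trans
    (Finset.sum_le_sum fun j _ => ?_))
  have h1 := (norm_apply_le_scalarOpNorm α 0 i).trans hα
  have h2 := (norm_apply_le_scalarOpNorm β j 0).trans hβ
  have h3 : ‖μ.1 (a i j) 0 0‖ ≤ C i j := by
    simpa [MState.apply_one_of_mem_CS hμ] using hC' i j μ.1 hμ.2
  rw [norm_mul, norm_mul]
  exact (mul_le_of_le_one_right (by positivity) h2).trans
    ((mul_le_of_le_one_left (norm_nonneg _) h1).trans h3)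

theorem le_stateSeminorm (hX : X ⊆ CS A 1) {n : ℕ} (a : Matrix (Fin n) (Fin n) A.carrier)
    {μ : MState A 1} (hμ : μ ∈ X) :
    scalarOpNorm (Matrix.of fun i j => μ (a i j) 0 0) ≤ stateSeminorm A X n a :=
  le_ciSup (stateSeminorm_bddAbove hX a) ⟨μ, hμ⟩

theorem norm_apply_le_stateSeminorm (hX : X ⊆ CS A 1) {a : Matrix (Fin 1) (Fin 1) A.carrier}
    {μ : MState A 1} (hμ : μ ∈ X) : ‖μ (a 0 0) 0 0‖ ≤ stateSeminorm A X 1 a :=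
  (norm_apply_le_scalarOpNorm (Matrix.of fun i j => μ (a i j) 0 0) 0 0).trans
    (le_stateSeminorm hX a hμ)

theorem isMatrixSeminorm_stateSeminorm (hX : X ⊆ CS A 1) :
    IsMatrixSeminorm A (stateSeminorm A X) := by
  have nonneg : ∀ n (v : Matrix (Fin n) (Fin n) A.carrier), 0 ≤ stateSeminorm A X n v :=
    fun n v => Real.iSup_nonneg fun μ => scalarOpNorm_nonneg _
  refine IsMatrixSeminorm.of_dsum_le nonneg (fun n v w => ?_) (fun n c v => ?_)
    (fun m n v w => ?_) (fun m n α v β => ?_)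
  · refine Real.iSup_le (fun μ => ?_) (add_nonneg (nonneg _ _) (nonneg _ _))
    refine le_trans ?_ (add_le_add (le_stateSeminorm hX v μ.2) (le_stateSeminorm hX w μ.2))
    refine le_trans (le_of_eq ?_) (scalarOpNorm_add_le _ _)
    congr 1; ext i j; simp
  · refine Real.iSup_le (fun μ => ?_) (mul_nonneg (norm_nonneg _) (nonneg _ _))
    refine le_trans ?_ (mul_le_mul_of_nonneg_left (le_stateSeminorm hX v μ.2) (norm_nonneg _))
    rw [← scalarOpNorm_smul]
    refine le_of_eq ?_
    congr 1; ext i j; simp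
  · refine Real.iSup_le (fun μ => ?_) (le_max_of_le_left (nonneg _ _))
    refine le_trans ?_ (max_le_max (le_stateSeminorm hX v μ.2) (le_stateSeminorm hX w μ.2))
    refine le_trans (le_of_eq ?_) (scalarOpNorm_dsumMat_le _ _)
    congr 1; exact mapMat_dsumMat ((Matrix.entryLinearMap ℂ ℂ 0 0).comp μ.1) v w
  · refine Real.iSup_le (fun μ => ?_) (mul_nonneg (mul_nonneg (scalarOpNorm_nonneg _) (nonneg _ _))
      (scalarOpNorm_nonneg _))
    have h1 := le_stateSeminorm hX v μ.2
    have e : (Matrix.of fun i j => μ.1 (mmulMat α v β i j) 0 0) =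
        α * (Matrix.of fun i j => μ.1 (v i j) 0 0) * β := by
      ext i j
      simp only [mmulMat, Matrix.of_apply, map_sum, map_smul, Matrix.sum_apply,
        Matrix.smul_apply, Matrix.mul_apply, smul_eq_mul, Finset.sum_mul]
      rw [Finset.sum_comm]
      refine Finset.sum_congr rfl fun x _ => Finset.sum_congr rfl fun y _ => ?_
      ring
    rw [e]
    refine (scalarOpNorm_mul_le _ _).trans (mul_le_mul_of_nonneg_right ?_ (scalarOpNorm_nonneg _))
    exact (scalarOpNorm_mul_le _ _).trans (mul_le_mul_of_nonneg_left h1 (scalarOpNorm_nonneg _))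

theorem stateSeminorm_conjTranspose (hX : X ⊆ CS A 1) {n : ℕ}
    (a : Matrix (Fin n) (Fin n) A.carrier) :
    stateSeminorm A X n a.conjTranspose = stateSeminorm A X n a := by
  unfold stateSeminorm
  congr 1
  ext μ
  rw [← scalarOpNorm_conjTranspose]
  congr 1
  ext i j
  have h := MState.IsCP.map_star (θ := μ.1) (hX μ.2).2
  simp [h]

end StateNorm

section MatrixMetric

variable {P : MOUS} {N : ∀ n : ℕ, Matrix (Fin n) (Fin n) P.carrier → ℝ} {n : ℕ}

theorem mpair_sub_left {r : ℕ} (φ ψ : MState P n) (a : Matrix (Fin r) (Fin r) P.carrier) :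
    mpair (φ - ψ) a = mpair φ a - mpair ψ a := by
  ext p q; simp [mpair]

theorem mpair_smul {r : ℕ} (φ : MState P n) (c : ℂ) (a : Matrix (Fin r) (Fin r) P.carrier) :
    mpair φ (c • a) = c • mpair φ a := by
  ext p q; simp [mpair]

/-- The set of values whose supremum is the matrix metric. -/
def DmetSet (P : MOUS) (N : ∀ n : ℕ, Matrix (Fin n) (Fin n) P.carrier → ℝ) (n : ℕ)
    (φ ψ : MState P n) : Set ℝ :=
  {x | ∃ (r : ℕ) (a : Matrix (Fin r) (Fin r) P.carrier), N r a ≤ 1 ∧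
    x = scalarOpNorm (mpair φ a - mpair ψ a)}

theorem Dmet_nonneg (φ ψ : MState P n) : 0 ≤ Dmet P N n φ ψ :=
  Real.sSup_nonneg (by rintro x ⟨r, a, -, rfl⟩; exact scalarOpNorm_nonneg _)

theorem Dmet_le {φ ψ : MState P n} {C : ℝ} (hC : 0 ≤ C)
    (h : ∀ (r : ℕ) (a : Matrix (Fin r) (Fin r) P.carrier), N r a ≤ 1 →
      scalarOpNorm (mpair φ a - mpair ψ a) ≤ C) : Dmet P N n φ ψ ≤ C :=
  Real.sSup_le (by rintro x ⟨r, a, ha, rfl⟩; exact h r a ha) hC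

theorem Dmet_self (φ : MState P n) : Dmet P N n φ φ = 0 :=
  le_antisymm (Dmet_le le_rfl fun r a _ => by rw [sub_self, scalarOpNorm_zero]) (Dmet_nonneg _ _)

theorem scalarOpNorm_mpair_sub_comm {r : ℕ} (φ ψ : MState P n)
    (a : Matrix (Fin r) (Fin r) P.carrier) :
    scalarOpNorm (mpair φ a - mpair ψ a) = scalarOpNorm (mpair ψ a - mpair φ a) := by
  rw [← scalarOpNorm_neg, neg_sub]

theorem DmetSet_comm (φ ψ : MState P n) : DmetSet P N n φ ψ = DmetSet P N n ψ φ := by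
  simp only [DmetSet, scalarOpNorm_mpair_sub_comm φ ψ]

theorem scalarOpNorm_mpair_sub_le_add {r : ℕ} (φ ψ χ : MState P n)
    (a : Matrix (Fin r) (Fin r) P.carrier) :
    scalarOpNorm (mpair φ a - mpair χ a) ≤
      scalarOpNorm (mpair φ a - mpair ψ a) + scalarOpNorm (mpair ψ a - mpair χ a) := by
  rw [← sub_add_sub_cancel _ (mpair ψ a)]
  exact scalarOpNorm_add_le _ _

theorem DmetSet_bddAbove_trans {φ ψ χ : MState P n} (h : BddAbove (DmetSet P N n φ ψ))
    (h' : BddAbove (DmetSet P N n ψ χ)) : BddAbove (DmetSet P N n φ χ) := by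
  obtain ⟨C, hC⟩ := h
  obtain ⟨D, hD⟩ := h'
  refine ⟨C + D, ?_⟩
  rintro x ⟨r, a, ha, rfl⟩
  exact (scalarOpNorm_mpair_sub_le_add φ ψ χ a).trans
    (add_le_add (hC ⟨r, a, ha, rfl⟩) (hD ⟨r, a, ha, rfl⟩))

theorem le_Dmet {φ ψ : MState P n} (h : BddAbove (DmetSet P N n φ ψ)) {r : ℕ}
    {a : Matrix (Fin r) (Fin r) P.carrier} (ha : N r a ≤ 1) :
    scalarOpNorm (mpair φ a - mpair ψ a) ≤ Dmet P N n φ ψ :=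
  le_csSup h ⟨r, a, ha, rfl⟩

theorem Dmet_triangle {φ ψ χ : MState P n} (h : BddAbove (DmetSet P N n φ ψ))
    (h' : BddAbove (DmetSet P N n ψ χ)) :
    Dmet P N n φ χ ≤ Dmet P N n φ ψ + Dmet P N n ψ χ :=
  Dmet_le (add_nonneg (Dmet_nonneg _ _) (Dmet_nonneg _ _)) fun _ a ha =>
    (scalarOpNorm_mpair_sub_le_add φ ψ χ a).trans (add_le_add (le_Dmet h ha) (le_Dmet h' ha))

theorem le_mul_Dmet (hN : IsMatrixSeminorm P N) {φ ψ : MState P n}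
    (h : BddAbove (DmetSet P N n φ ψ)) {r : ℕ} {a : Matrix (Fin r) (Fin r) P.carrier} {c : ℝ}
    (hc : 0 < c) (ha : N r a ≤ c) :
    scalarOpNorm (mpair φ a - mpair ψ a) ≤ c * Dmet P N n φ ψ := by
  have h1 : N r (((c⁻¹ : ℝ) : ℂ) • a) ≤ 1 := by
    rw [hN.smul_eq, Complex.norm_real, Real.norm_eq_abs, abs_of_pos (inv_pos.2 hc),
      inv_mul_le_iff₀ hc, mul_one]
    exact ha
  have h2 := le_Dmet h h1
  rw [mpair_smul, mpair_smul, ← smul_sub, scalarOpNorm_smul, Complex.norm_real, Real.norm_eq_abs,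
    abs_of_pos (inv_pos.2 hc), inv_mul_le_iff₀ hc] at h2
  exact h2

theorem norm_apply_sub_le {φ ψ : MState P n} (x : P.carrier) (i j : Fin n) :
    ‖φ x i j - ψ x i j‖ ≤ scalarOpNorm (mpair φ (Matrix.of fun _ _ => x : Matrix (Fin 1) (Fin 1) _)
      - mpair ψ (Matrix.of fun _ _ => x)) :=
  norm_apply_le_scalarOpNorm (mpair φ (Matrix.of fun _ _ => x : Matrix (Fin 1) (Fin 1) _)
      - mpair ψ (Matrix.of fun _ _ => x)) (0, i) (0, j)

theorem continuous_BWtop_apply (P : MOUS) (n : ℕ) (x : P.carrier) :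
    @Continuous _ _ (BWtop P n) _ fun χ : {φ : MState P n // φ ∈ CS P n} => χ.1 x := by
  let _ := lmTop P n
  let _ := BWtop P n
  have h1 : Continuous fun χ : {φ : MState P n // φ ∈ CS P n} => χ.1 := continuous_induced_dom
  have h2 : Continuous fun φ : MState P n => (φ : P.carrier → Matrix (Fin n) (Fin n) ℂ) :=
    continuous_induced_dom
  exact (continuous_apply x).comp (h2.comp h1)

theorem isOpen_Dmet_ball (htop : Dtop P N n = BWtop P n) (φ : {φ : MState P n // φ ∈ CS P n})
    {ε : ℝ} (hε : 0 < ε) : @IsOpen _ (BWtop P n) {ψ | Dmet P N n φ.1 ψ.1 < ε} := by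
  rw [← htop]
  exact TopologicalSpace.isOpen_generateFrom_of_mem ⟨φ, ε, hε, rfl⟩

/-- The straight line from `φ` to `ψ`. -/
def stateSegment (φ ψ : MState P n) (t : ℝ) : MState P n :=
  ((1 - t : ℝ) : ℂ) • φ + (t : ℂ) • ψ

theorem stateSegment_mem {φ ψ : MState P n} (hφ : φ ∈ CS P n) (hψ : ψ ∈ CS P n) {t : ℝ}
    (ht : t ∈ Set.Icc (0 : ℝ) 1) : stateSegment φ ψ t ∈ CS P n := by
  refine ⟨?_, fun r v hv => ?_⟩
  · rw [stateSegment, LinearMap.add_apply, LinearMap.smul_apply, LinearMap.smul_apply, hφ.1, hψ.1,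
      ← add_smul]
    simp
  · have : mpair (stateSegment φ ψ t) v = ((1 - t : ℝ) : ℂ) • mpair φ v + (t : ℂ) • mpair ψ v := by
      ext p q; simp [mpair, stateSegment]
    rw [this]
    exact ((hφ.2 r v hv).smul (by rw [Complex.zero_le_real]; linarith [ht.2])).add
      ((hψ.2 r v hv).smul (by rw [Complex.zero_le_real]; exact ht.1))

theorem mpair_stateSegment_sub {φ ψ : MState P n} {s t : ℝ} {r : ℕ}
    (a : Matrix (Fin r) (Fin r) P.carrier) :
    mpair (stateSegment φ ψ s) a - mpair (stateSegment φ ψ t) a =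
      ((t - s : ℝ) : ℂ) • (mpair φ a - mpair ψ a) := by
  ext p q
  simp [mpair, stateSegment]
  ring

theorem DmetSet_bddAbove_of_stateSegment {φ ψ : MState P n} {s t : ℝ} (hst : s ≠ t)
    (h : BddAbove (DmetSet P N n (stateSegment φ ψ s) (stateSegment φ ψ t))) :
    BddAbove (DmetSet P N n φ ψ) := by
  obtain ⟨C, hC⟩ := h
  have hpos : 0 < |t - s| := abs_pos.2 (sub_ne_zero.2 hst.symm)
  refine ⟨|t - s|⁻¹ * C, ?_⟩
  rintro x ⟨r, a, ha, rfl⟩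
  have := hC ⟨r, a, ha, rfl⟩
  rw [mpair_stateSegment_sub, scalarOpNorm_smul, Complex.norm_real, Real.norm_eq_abs] at this
  rwa [← div_eq_inv_mul, le_div_iff₀' hpos]

/-- When the matrix metric topology is the BW-topology, the supremum defining the matrix metric
is finite. -/
theorem DmetSet_bddAbove_of_top_eq (htop : Dtop P N n = BWtop P n) {φ ψ : MState P n}
    (hφ : φ ∈ CS P n) (hψ : ψ ∈ CS P n) : BddAbove (DmetSet P N n φ ψ) := by
  by_contra hunb
  obtain ⟨x, i, j, hx⟩ : ∃ x i j, φ x i j ≠ ψ x i j := by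
    by_contra! h
    have e : φ = ψ := by ext x i j; exact h x i j
    refine hunb ⟨0, ?_⟩
    rintro y ⟨r, a, -, rfl⟩
    rw [e, sub_self, scalarOpNorm_zero]
  let seg : CofiniteTopology (Set.Icc (0 : ℝ) 1) → {φ : MState P n // φ ∈ CS P n} := fun t =>
    ⟨stateSegment φ ψ (CofiniteTopology.of.symm t).1,
      stateSegment_mem hφ hψ (CofiniteTopology.of.symm t).2⟩
  have hcont : @Continuous _ _ _ (Dtop P N n) seg := by
    refine continuous_generateFrom_iff.2 ?_
    rintro U ⟨χ, ε, hε, rfl⟩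
    refine CofiniteTopology.isOpen_iff.2 fun _ => Set.Subsingleton.finite fun s hs t ht => ?_
    have key : ∀ s, s ∈ (seg ⁻¹' {ψ | Dmet P N n χ.1 ψ.1 < ε})ᶜ →
        BddAbove (DmetSet P N n χ.1 (seg s).1) := fun s hs => by
      by_contra h
      refine hs ?_
      show sSup (DmetSet P N n χ.1 (seg s).1) < ε
      rwa [Real.sSup_of_not_bddAbove h]
    by_contra hne
    refine hunb (DmetSet_bddAbove_of_stateSegment
      (s := (CofiniteTopology.of.symm s).1) (t := (CofiniteTopology.of.symm t).1)
      (fun h => hne (CofiniteTopology.of.symm.injective (Subtype.ext h))) ?_)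
    refine DmetSet_bddAbove_trans (ψ := χ.1) ?_ (key t ht)
    rw [DmetSet_comm]
    exact key s hs
  rw [htop] at hcont
  let _ := BWtop P n
  have hev : Continuous fun t => (seg t).1 x i j :=
    (continuous_apply_apply i j).comp ((continuous_BWtop_apply P n x).comp hcont)
  have hval : ∀ t, (seg t).1 x i j - φ x i j =
      ((CofiniteTopology.of.symm t).1 : ℂ) * (ψ x i j - φ x i j) := fun t => by
    simp [seg, stateSegment]
    ring
  set d := ‖ψ x i j - φ x i j‖ with hd
  have hdpos : 0 < d := norm_pos_iff.2 (sub_ne_zero.2 hx.symm)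
  have hopen := (Metric.isOpen_ball (x := φ x i j) (ε := d / 2)).preimage hev
  have hnorm : ∀ t, dist ((seg t).1 x i j) (φ x i j) = (CofiniteTopology.of.symm t).1 * d :=
    fun t => by
      rw [dist_eq_norm, hval, norm_mul, Complex.norm_real, Real.norm_eq_abs,
        abs_of_nonneg (CofiniteTopology.of.symm t).2.1]
  have hfin := CofiniteTopology.isOpen_iff.1 hopen
    ⟨CofiniteTopology.of ⟨0, by simp⟩, by
      rw [Set.mem_preimage, Metric.mem_ball, hnorm]; simp [hdpos]⟩
  have hinf : (Set.Icc (1 / 2 : ℝ) 1).Infinite := Set.Icc_infinite (by norm_num)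
  refine hinf ((hfin.image fun t => (CofiniteTopology.of.symm t).1).subset fun t ht => ?_)
  refine ⟨CofiniteTopology.of ⟨t, by linarith [ht.1], ht.2⟩, ?_, rfl⟩
  rw [Set.mem_compl_iff, Set.mem_preimage, Metric.mem_ball, hnorm]
  show ¬ (t * d < d / 2)
  nlinarith [ht.1]

end MatrixMetric

section LipNormCriterion

variable {P : MOUS} {N : ∀ n : ℕ, Matrix (Fin n) (Fin n) P.carrier → ℝ}

/-- Modulo scalars, the unit ball of `N₁` is totally bounded in the uniform norm on the state
space. -/
def TotallyBoundedOnStates (P : MOUS) (N : ∀ n : ℕ, Matrix (Fin n) (Fin n) P.carrier → ℝ) : Prop :=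
  ∀ ε > 0, ∃ F : Set P.carrier, F.Finite ∧ ∀ p : Matrix (Fin 1) (Fin 1) P.carrier, N 1 p ≤ 1 →
    ∃ f ∈ F, ∃ c : ℂ, ∀ μ ∈ CS P 1, ‖μ (p 0 0 - f) 0 0 - c‖ ≤ ε

theorem TotallyBoundedOnStates.exists_radius (hT : TotallyBoundedOnStates P N) :
    ∃ R, 0 ≤ R ∧ ∀ p : Matrix (Fin 1) (Fin 1) P.carrier, N 1 p ≤ 1 →
      ∃ c : ℂ, ∀ μ ∈ CS P 1, ‖μ (p 0 0) 0 0 - c‖ ≤ R := by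
  obtain ⟨F, hF, hFN⟩ := hT 1 one_pos
  choose C hC0 hC using fun b : P.carrier => MState.IsCP.exists_bound b
  obtain ⟨B, hB⟩ := (hF.image C).bddAbove
  refine ⟨1 + max B 0, by positivity, fun p hp => ?_⟩
  obtain ⟨f, hf, c, hc⟩ := hFN p hp
  refine ⟨c, fun μ hμ => ?_⟩
  have h1 := hC f μ hμ.2
  rw [MState.apply_one_of_mem_CS hμ, Complex.one_re, mul_one] at h1
  have h2 := hB ⟨f, hf, rfl⟩
  calc ‖μ (p 0 0) 0 0 - c‖ = ‖(μ (p 0 0 - f) 0 0 - c) + μ f 0 0‖ := by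
        rw [map_sub, Matrix.sub_apply]; congr 1; ring
    _ ≤ ‖μ (p 0 0 - f) 0 0 - c‖ + ‖μ f 0 0‖ := norm_add_le _ _
    _ ≤ 1 + max B 0 := add_le_add (hc μ hμ) (h1.trans (h2.trans (le_max_left _ _)))

theorem IsMatrixSeminorm.mmul_le_one (hN : IsMatrixSeminorm P N) {r : ℕ}
    {a : Matrix (Fin r) (Fin r) P.carrier} {t : ℝ} (ha : N r a ≤ t)
    {α : Matrix (Fin 1) (Fin r) ℂ} {β : Matrix (Fin r) (Fin 1) ℂ}
    (hα : scalarOpNorm α ≤ 1) (hβ : scalarOpNorm β ≤ 1) : N 1 (mmulMat α a β) ≤ t := by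
  have h0 := hN.nonneg r a
  calc N 1 (mmulMat α a β) ≤ scalarOpNorm α * N r a * scalarOpNorm β := hN.mmul_le _ _ _ _ _
    _ ≤ 1 * N r a * 1 := by
        gcongr
        exact scalarOpNorm_nonneg _
    _ ≤ t := by simpa using ha

theorem scalarOpNorm_mpair_sub_le_of_radius (hN : IsMatrixSeminorm P N) {R : ℝ}
    (hR : ∀ p : Matrix (Fin 1) (Fin 1) P.carrier, N 1 p ≤ 1 →
      ∃ c : ℂ, ∀ μ ∈ CS P 1, ‖μ (p 0 0) 0 0 - c‖ ≤ R)
    {k : ℕ} {φ ψ : MState P k} (hφ : φ ∈ CS P k) (hψ : ψ ∈ CS P k) {r : ℕ}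
    {a : Matrix (Fin r) (Fin r) P.carrier} (ha : N r a ≤ 1) :
    scalarOpNorm (mpair φ a - mpair ψ a) ≤ (k : ℝ) ^ 2 * (4 * R) := by
  rw [← mpair_sub_left]
  refine scalarOpNorm_mpair_le fun α β hα hβ i j => ?_
  obtain ⟨c, hc⟩ := hR _ (hN.mmul_le_one ha hα hβ)
  exact norm_sub_matrixState_apply_le hc hφ hψ i j

theorem TotallyBoundedOnStates.DmetSet_bddAbove (hT : TotallyBoundedOnStates P N)
    (hN : IsMatrixSeminorm P N) {k : ℕ} {φ ψ : MState P k} (hφ : φ ∈ CS P k) (hψ : ψ ∈ CS P k) :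
    BddAbove (DmetSet P N k φ ψ) := by
  obtain ⟨R, -, hR⟩ := hT.exists_radius
  refine ⟨(k : ℝ) ^ 2 * (4 * R), ?_⟩
  rintro x ⟨r, a, ha, rfl⟩
  exact scalarOpNorm_mpair_sub_le_of_radius hN hR hφ hψ ha

theorem TotallyBoundedOnStates.exists_const_of_eq_zero (hT : TotallyBoundedOnStates P N)
    (hN : IsMatrixSeminorm P N) {p : Matrix (Fin 1) (Fin 1) P.carrier} (hp : N 1 p = 0) :
    ∃ c : ℂ, ∀ μ ∈ CS P 1, μ (p 0 0) 0 0 = c := by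
  rcases (CS P 1).eq_empty_or_nonempty with h | ⟨μ₀, hμ₀⟩
  · exact ⟨0, by simp [h]⟩
  obtain ⟨R, hR0, hR⟩ := hT.exists_radius
  refine ⟨μ₀ (p 0 0) 0 0, fun μ hμ => ?_⟩
  by_contra hne
  have hd : 0 < ‖μ (p 0 0) 0 0 - μ₀ (p 0 0) 0 0‖ := norm_pos_iff.2 (sub_ne_zero.2 hne)
  set d := ‖μ (p 0 0) 0 0 - μ₀ (p 0 0) 0 0‖ with hd'
  let t : ℝ := (2 * R + 1) / d
  have ht : 0 < t := by positivity
  obtain ⟨c, hc⟩ := hR ((t : ℂ) • p) (by rw [hN.smul_eq, hp, mul_zero]; exact zero_le_one)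
  have h1 := hc μ hμ
  have h2 := hc μ₀ hμ₀
  have h3 : t * d ≤ 2 * R := by
    calc t * d = ‖(μ (((t : ℂ) • p) 0 0) 0 0 - c) - (μ₀ (((t : ℂ) • p) 0 0) 0 0 - c)‖ := by
          rw [sub_sub_sub_cancel_right]
          simp only [Matrix.smul_apply, map_smul, smul_eq_mul]
          rw [← mul_sub, norm_mul, Complex.norm_real, Real.norm_eq_abs, abs_of_pos ht]
      _ ≤ R + R := (norm_sub_le _ _).trans (add_le_add h1 h2)
      _ = 2 * R := by ring
  rw [div_mul_cancel₀ _ hd.ne'] at h3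
  linarith

theorem IsMatrixSeminorm.entry_le (hN : IsMatrixSeminorm P N) {n : ℕ}
    {v : Matrix (Fin n) (Fin n) P.carrier} (hv : N n v = 0) (i j : Fin n) :
    N 1 (Matrix.of fun _ _ => v i j) = 0 := by
  refine le_antisymm ?_ (hN.nonneg _ _)
  have h := hN.mmul_le n 1 (Matrix.of fun _ k => if k = i then 1 else 0) v
    (Matrix.of fun k _ => if k = j then 1 else 0)
  rw [hv, mul_zero, zero_mul] at h
  refine le_trans (le_of_eq ?_) h
  congr 1
  ext _ _
  simp [mmulMat, ite_smul, Finset.sum_ite_eq']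

theorem TotallyBoundedOnStates.exists_ball_subset (hT : TotallyBoundedOnStates P N)
    (hN : IsMatrixSeminorm P N) {n : ℕ} (ψ₀ : {φ : MState P n // φ ∈ CS P n}) {η : ℝ}
    (hη : 0 < η) :
    ∀ᶠ ψ in @nhds _ (BWtop P n) ψ₀, Dmet P N n ψ₀.1 ψ.1 < η := by
  let _ := BWtop P n
  set δ : ℝ := η / (5 * n ^ 2 + 1) with hδ
  have hδpos : 0 < δ := by positivity
  obtain ⟨F, hF, hFN⟩ := hT δ hδpos
  have hev : ∀ᶠ ψ in nhds ψ₀, ∀ f ∈ F, ∀ i j, ‖(ψ.1 - ψ₀.1) f i j‖ < δ := by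
    rw [Filter.eventually_all_finite hF]
    intro f _
    rw [Filter.eventually_all]
    intro i
    rw [Filter.eventually_all]
    intro j
    have hc : Continuous fun χ : {φ : MState P n // φ ∈ CS P n} => χ.1 f i j :=
      (continuous_apply_apply i j).comp (continuous_BWtop_apply P n f)
    have := hc.continuousAt.eventually (Metric.ball_mem_nhds (ψ₀.1 f i j) hδpos)
    filter_upwards [this] with ψ hψ
    simpa [dist_eq_norm] using hψ
  filter_upwards [hev] with ψ hψ
  have h1 : Dmet P N n ψ₀.1 ψ.1 ≤ (n : ℝ) ^ 2 * (5 * δ) := by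
    refine Dmet_le (by positivity) fun r a ha => ?_
    rw [scalarOpNorm_mpair_sub_comm, ← mpair_sub_left]
    refine scalarOpNorm_mpair_le fun α β hα hβ i j => ?_
    obtain ⟨f, hf, c, hc⟩ := hFN _ (hN.mmul_le_one ha hα hβ)
    have h2 := norm_sub_matrixState_apply_le hc ψ.2 ψ₀.2 i j
    rw [map_sub, Matrix.sub_apply] at h2
    have h3 := hψ f hf i j
    have h4 := norm_le_norm_sub_add ((ψ.1 - ψ₀.1) (mmulMat α a β 0 0) i j) ((ψ.1 - ψ₀.1) f i j)
    linarith
  refine h1.trans_lt ?_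
  rw [hδ, mul_div_assoc', mul_div_assoc', div_lt_iff₀ (by positivity)]
  nlinarith

theorem TotallyBoundedOnStates.top_eq (hT : TotallyBoundedOnStates P N)
    (hN : IsMatrixSeminorm P N) (n : ℕ) : Dtop P N n = BWtop P n := by
  refine le_antisymm ?_ (le_generateFrom ?_)
  · rw [BWtop, lmTop, induced_compose, ← continuous_iff_le_induced]
    let _ := Dtop P N n
    refine continuous_pi fun x => continuous_pi fun i => continuous_pi fun j => ?_
    refine continuous_iff_continuousAt.2 fun ψ₀ => Metric.tendsto_nhds.2 fun ε hε => ?_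
    set s := N 1 (Matrix.of fun _ _ => x) + 1 with hs
    have hspos : 0 < s := add_pos_of_nonneg_of_pos (hN.nonneg _ _) one_pos
    have hopen : IsOpen {ψ : {φ : MState P n // φ ∈ CS P n} | Dmet P N n ψ₀.1 ψ.1 < ε / s} :=
      TopologicalSpace.isOpen_generateFrom_of_mem ⟨ψ₀, ε / s, by positivity, rfl⟩
    filter_upwards [hopen.mem_nhds (by
      show Dmet P N n ψ₀.1 ψ₀.1 < ε / s
      rw [Dmet_self]; positivity)] with ψ hψ
    have hψ : Dmet P N n ψ₀.1 ψ.1 < ε / s := hψ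
    rw [dist_comm, dist_eq_norm]
    refine (norm_apply_sub_le x i j).trans_lt ?_
    refine (le_mul_Dmet hN (hT.DmetSet_bddAbove hN ψ₀.2 ψ.2) hspos (le_add_of_nonneg_right
      zero_le_one)).trans_lt ?_
    rwa [lt_div_iff₀' hspos] at hψ
  · rintro U ⟨φ, ε, -, rfl⟩
    let _ := BWtop P n
    refine isOpen_iff_mem_nhds.2 fun ψ₀ hψ₀ => ?_
    have hψ₀ : Dmet P N n φ.1 ψ₀.1 < ε := hψ₀
    filter_upwards [hT.exists_ball_subset hN ψ₀ (sub_pos.2 hψ₀)] with ψ hψ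
    have := Dmet_triangle (hT.DmetSet_bddAbove hN φ.2 ψ₀.2) (hT.DmetSet_bddAbove hN ψ₀.2 ψ.2)
    show Dmet P N n φ.1 ψ.1 < ε
    linarith

theorem TotallyBoundedOnStates.isMatrixLipNorm (hT : TotallyBoundedOnStates P N)
    (hN : IsMatrixSeminorm P N)
    (hstar : ∀ n (v : Matrix (Fin n) (Fin n) P.carrier), N n v.conjTranspose = N n v)
    (hone : ∀ n (lam : Matrix (Fin n) (Fin n) ℂ), N n (Matrix.of fun i j => lam i j • P.one) = 0)
    (hsep : ∀ p : P.carrier, (∀ μ ∈ CS P 1, μ p 0 0 = 0) → p = 0) : IsMatrixLipNorm P N where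
  nonneg := hN.nonneg
  add_le := hN.add_le
  smul_eq := hN.smul_eq
  null_iff n v := by
    refine ⟨fun hv => ?_, ?_⟩
    · choose c hc using fun i j => hT.exists_const_of_eq_zero hN (hN.entry_le hv i j)
      refine ⟨Matrix.of c, ?_⟩
      ext i j
      refine sub_eq_zero.1 (hsep _ fun μ hμ => ?_)
      have := hc i j μ hμ
      simp only [Matrix.of_apply] at this
      simp [this, MState.apply_one_of_mem_CS hμ]
    · rintro ⟨lam, rfl⟩
      exact hone n lam
  dsum_eq := hN.dsum_eq
  mmul_le := hN.mmul_le
  star_eq := hstar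
  top_eq := hT.top_eq hN

end LipNormCriterion

theorem exists_finite_subset_forall_norm_sub_lt {α ι : Type*} [Fintype ι] {S : Set α}
    {G : α → ι → ℂ} {B : ℝ} (hB : ∀ s ∈ S, ∀ i, ‖G s i‖ ≤ B) {ε : ℝ} (hε : 0 < ε) :
    ∃ F ⊆ S, F.Finite ∧ ∀ s ∈ S, ∃ f ∈ F, ∀ i, ‖G s i - G f i‖ < ε := by
  have hb : TotallyBounded (G '' S) := by
    refine (isCompact_closedBall (0 : ι → ℂ) (max B 0)).totallyBounded.subset ?_
    rintro _ ⟨s, hs, rfl⟩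
    rw [mem_closedBall_zero_iff, pi_norm_le_iff_of_nonneg (le_max_right _ _)]
    exact fun i => (hB s hs i).trans (le_max_left _ _)
  obtain ⟨t, hts, htf, ht⟩ := Metric.finite_approx_of_totallyBounded hb ε hε
  obtain ⟨F, hFS, hFf, rfl⟩ := (Set.exists_subset_image_finite_and (p := (· = t))).1
    ⟨t, hts, htf, rfl⟩
  refine ⟨F, hFS, hFf, fun s hs => ?_⟩
  obtain ⟨y, ⟨f, hf, rfl⟩, hy⟩ := Set.mem_iUnion₂.1 (ht ⟨s, hs, rfl⟩)
  refine ⟨f, hf, fun i => ?_⟩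
  exact (norm_le_pi_norm (G s - G f) i).trans_lt (by rwa [Metric.mem_ball, dist_eq_norm] at hy)

section PairNet

variable {A : MOUS} {L : ∀ n : ℕ, Matrix (Fin n) (Fin n) A.carrier → ℝ} {X : Set (MState A 1)}

theorem IsMatrixLipNorm.DmetSet_bddAbove (hL : IsMatrixLipNorm A L) {n : ℕ} {φ ψ : MState A n}
    (hφ : φ ∈ CS A n) (hψ : ψ ∈ CS A n) : BddAbove (DmetSet A L n φ ψ) :=
  DmetSet_bddAbove_of_top_eq (hL.top_eq n) hφ hψ

theorem IsMatrixLipNorm.norm_apply_sub_le (hL : IsMatrixLipNorm A L) {μ ν : MState A 1}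
    (hμ : μ ∈ CS A 1) (hν : ν ∈ CS A 1) {a : A.carrier} {c : ℝ} (hc : 0 < c)
    (ha : L 1 (Matrix.of fun _ _ => a) ≤ c) : ‖μ a 0 0 - ν a 0 0‖ ≤ c * Dmet A L 1 μ ν :=
  (_root_.norm_apply_sub_le a 0 0).trans
    (le_mul_Dmet hL.isMatrixSeminorm (hL.DmetSet_bddAbove hμ hν) hc ha)

theorem IsMatrixLipNorm.exists_finite_Dmet_net (hL : IsMatrixLipNorm A L) (hX : X ⊆ CS A 1)
    (hcpt : @IsCompact _ (lmTop A 1) X) {ε : ℝ} (hε : 0 < ε) :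
    ∃ T ⊆ X, T.Finite ∧ ∀ μ ∈ X, ∃ ν ∈ T, Dmet A L 1 ν μ < ε := by
  let _ := lmTop A 1
  let _ := BWtop A 1
  have hY : IsCompact ((↑) ⁻¹' X : Set {φ : MState A 1 // φ ∈ CS A 1}) := by
    have hi : Topology.IsInducing ((↑) : {φ : MState A 1 // φ ∈ CS A 1} → MState A 1) := ⟨rfl⟩
    rw [hi.isCompact_iff, Set.image_preimage_eq_of_subset (by simpa using hX)]
    exact hcpt
  obtain ⟨t, ht⟩ := hY.elim_nhds_subcover' (fun ν _ => {ψ | Dmet A L 1 ν.1 ψ.1 < ε})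
    fun ν _ => (isOpen_Dmet_ball (hL.top_eq 1) ν hε).mem_nhds (by
      show Dmet A L 1 ν.1 ν.1 < ε
      rwa [Dmet_self])
  refine ⟨(fun ν : ((↑) ⁻¹' X : Set {φ : MState A 1 // φ ∈ CS A 1}) => ν.1.1) '' (t : Set _), ?_, t.finite_toSet.image _, fun μ hμ => ?_⟩
  · rintro _ ⟨ν, -, rfl⟩
    exact ν.2
  · obtain ⟨ν, hν, hνμ⟩ := Set.mem_iUnion₂.1 (@ht ⟨μ, hX hμ⟩ hμ)
    exact ⟨ν.1.1, ⟨ν, hν, rfl⟩, hνμ⟩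

/-- Pairs of bounded Lipschitz seminorm which are close on `X` form, up to a common scalar, a
totally bounded set for the uniform norm on `X`. -/
theorem IsMatrixLipNorm.exists_finite_pair_net (hL : IsMatrixLipNorm A L) (hX : X ⊆ CS A 1)
    (hcpt : @IsCompact _ (lmTop A 1) X) {ε : ℝ} (hε : 0 < ε) (κ : ℝ) :
    ∃ F : Set (A.carrier × A.carrier), F.Finite ∧ ∀ a : A.carrier × A.carrier,
      L 1 (Matrix.of fun _ _ => a.1) ≤ 2 → L 1 (Matrix.of fun _ _ => a.2) ≤ 2 →
      (∀ μ ∈ X, ‖μ (a.1 - a.2) 0 0‖ ≤ κ) → ∃ f ∈ F, ∃ c : ℂ, ∀ μ ∈ X,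
        ‖μ (a.1 - f.1) 0 0 - c‖ ≤ ε ∧ ‖μ (a.2 - f.2) 0 0 - c‖ ≤ ε := by
  rcases X.eq_empty_or_nonempty with rfl | ⟨ν₀, hν₀⟩
  · exact ⟨{0}, Set.finite_singleton _, fun a _ _ _ => ⟨0, rfl, 0, by simp⟩⟩
  obtain ⟨T, hTX, hTf, hT⟩ := hL.exists_finite_Dmet_net hX hcpt (show 0 < ε / 5 by positivity)
  have := hTf.fintype
  obtain ⟨B, hB⟩ := (hTf.image fun ν => Dmet A L 1 ν ν₀).bddAbove
  let S : Set (A.carrier × A.carrier) := {a | L 1 (Matrix.of fun _ _ => a.1) ≤ 2 ∧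
    L 1 (Matrix.of fun _ _ => a.2) ≤ 2 ∧ ∀ μ ∈ X, ‖μ (a.1 - a.2) 0 0‖ ≤ κ}
  let G : A.carrier × A.carrier → T ⊕ T → ℂ := fun a =>
    Sum.elim (fun ν => ν.1 a.1 0 0 - ν₀ a.1 0 0) (fun ν => ν.1 a.2 0 0 - ν₀ a.1 0 0)
  have hbound : ∀ ν : T, ∀ a : A.carrier, L 1 (Matrix.of fun _ _ => a) ≤ 2 →
      ‖ν.1 a 0 0 - ν₀ a 0 0‖ ≤ 2 * B := fun ν a ha =>
    (hL.norm_apply_sub_le (hX (hTX ν.2)) (hX hν₀) two_pos ha).trans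
      (mul_le_mul_of_nonneg_left (hB ⟨ν, ν.2, rfl⟩) two_pos.le)
  have hG : ∀ a ∈ S, ∀ i, ‖G a i‖ ≤ 2 * B + κ := by
    rintro a ⟨h1, h2, h3⟩ i
    have hκ := h3 ν₀ hν₀
    have hκ0 : 0 ≤ κ := (norm_nonneg _).trans hκ
    rcases i with ν | ν
    · exact (hbound ν _ h1).trans (le_add_of_nonneg_right hκ0)
    · calc ‖ν.1 a.2 0 0 - ν₀ a.1 0 0‖ = ‖(ν.1 a.2 0 0 - ν₀ a.2 0 0) - ν₀ (a.1 - a.2) 0 0‖ := by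
            rw [map_sub, Matrix.sub_apply]; congr 1; ring
        _ ≤ _ := (norm_sub_le _ _).trans (add_le_add (hbound ν _ h2) hκ)
  obtain ⟨F, hFS, hFf, hF⟩ := exists_finite_subset_forall_norm_sub_lt hG
    (show 0 < ε / 5 by positivity)
  refine ⟨F, hFf, fun a h1 h2 h3 => ?_⟩
  obtain ⟨f, hf, hfa⟩ := hF a ⟨h1, h2, h3⟩
  refine ⟨f, hf, ν₀ (a.1 - f.1) 0 0, fun μ hμ => ?_⟩
  obtain ⟨ν, hν, hνμ⟩ := hT μ hμ
  obtain ⟨hf1, hf2, -⟩ := hFS hf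
  have key : ∀ x y : A.carrier, L 1 (Matrix.of fun _ _ => x) ≤ 2 →
      L 1 (Matrix.of fun _ _ => y) ≤ 2 → ∀ c : ℂ, ‖ν (x - y) 0 0 - c‖ ≤ ε / 5 →
      ‖μ (x - y) 0 0 - c‖ ≤ ε := fun x y hx hy c hc => by
    have hxy : L 1 (Matrix.of fun _ _ => x - y) ≤ 4 := by
      have h := hL.add_le 1 (Matrix.of fun _ _ => x) ((-1 : ℂ) • Matrix.of fun _ _ => y)
      rw [hL.smul_eq] at h
      have e : (Matrix.of fun _ _ => x : Matrix (Fin 1) (Fin 1) A.carrier) +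
          (-1 : ℂ) • Matrix.of (fun _ _ => y) = Matrix.of fun _ _ => x - y := by
        ext i j; simp [sub_eq_add_neg]
      rw [e, norm_neg, norm_one] at h
      linarith
    have h := hL.norm_apply_sub_le (hX (hTX hν)) (hX hμ) (show (0 : ℝ) < 4 by norm_num) hxy
    rw [norm_sub_rev] at h
    have := norm_sub_le_norm_sub_add_norm_sub (μ (x - y) 0 0) (ν (x - y) 0 0) c
    linarith
  refine ⟨key _ _ h1 hf1 _ ?_, key _ _ h2 hf2 _ ?_⟩
  · refine le_trans (le_of_eq ?_) (hfa (Sum.inl ⟨ν, hν⟩)).le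
    simp only [G, Sum.elim_inl, map_sub, Matrix.sub_apply]
    congr 1; ring
  · refine le_trans (le_of_eq ?_) (hfa (Sum.inr ⟨ν, hν⟩)).le
    simp only [G, Sum.elim_inr, map_sub, Matrix.sub_apply]
    congr 1; ring

end PairNet

section Products

variable {A B W : MOUS}

theorem mpair_comp {n r : ℕ} (ψ : MState B n) (f : A.carrier →ₗ[ℂ] B.carrier)
    (a : Matrix (Fin r) (Fin r) A.carrier) : mpair (ψ.comp f : MState A n) a = mpair ψ (mapMat f a) :=
  rfl

theorem IsUCP.comp_mem_CS {f : A.carrier →ₗ[ℂ] B.carrier} (hf : IsUCP A B f) {n : ℕ}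
    {ψ : MState B n} (hψ : ψ ∈ CS B n) : ψ.comp f ∈ CS A n :=
  ⟨by rw [LinearMap.comp_apply, hf.unital, hψ.1], fun r v hv => hψ.2 r _ (hf.cp r v hv)⟩

theorem isUCP_fstL (A B : MOUS) : IsUCP (A.prod B) A (fstL A B) := ⟨rfl, fun _ _ hv => hv.1⟩

theorem isUCP_sndL (A B : MOUS) : IsUCP (A.prod B) B (sndL A B) := ⟨rfl, fun _ _ hv => hv.2⟩

/-- The inclusion of the first summand. -/
def inlL (A B : MOUS) : A.carrier →ₗ[ℂ] (A.prod B).carrier := LinearMap.inl ℂ A.carrier B.carrier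

/-- The inclusion of the second summand. -/
def inrL (A B : MOUS) : B.carrier →ₗ[ℂ] (A.prod B).carrier := LinearMap.inr ℂ A.carrier B.carrier

theorem MState.IsCP.comp_inlL {n : ℕ} {θ : MState (A.prod B) n} (hθ : θ.IsCP) :
    MState.IsCP (θ.comp (inlL A B)) := fun r v hv =>
  hθ r (mapMat (inlL A B) v) ⟨hv, B.zero_mem_pos r⟩

theorem MState.IsCP.comp_inrL {n : ℕ} {θ : MState (A.prod B) n} (hθ : θ.IsCP) :
    MState.IsCP (θ.comp (inrL A B)) := fun r v hv =>
  hθ r (mapMat (inrL A B) v) ⟨A.zero_mem_pos r, hv⟩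

theorem inlL_add_inrL (b : (A.prod B).carrier) : inlL A B b.1 + inrL A B b.2 = b :=
  Prod.ext (add_zero _) (zero_add _)

theorem norm_prod_state_apply_le {b : (A.prod B).carrier} {R : ℝ}
    (h₁ : ∀ μ ∈ CS A 1, ‖μ b.1 0 0‖ ≤ R) (h₂ : ∀ μ ∈ CS B 1, ‖μ b.2 0 0‖ ≤ R)
    {μ : MState (A.prod B) 1} (hμ : μ ∈ CS (A.prod B) 1) : ‖μ b 0 0‖ ≤ R := by
  have hcp : MState.IsCP μ := hμ.2
  have e1 := hcp.comp_inlL.norm_apply_le h₁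
  have e2 := hcp.comp_inrL.norm_apply_le h₂
  have hsum : ∀ x : (A.prod B).carrier, μ (inlL A B x.1) 0 0 + μ (inrL A B x.2) 0 0 = μ x 0 0 :=
    fun x => by rw [← Matrix.add_apply, ← map_add, inlL_add_inrL]
  have h1 : (μ (inlL A B A.one) 0 0).re + (μ (inrL A B B.one) 0 0).re = 1 := by
    rw [← Complex.add_re]
    have := hsum (A.prod B).one
    rw [MState.apply_one_of_mem_CS hμ] at this
    exact congrArg Complex.re this
  rw [← hsum b]
  calc _ ≤ _ := norm_add_le _ _
    _ ≤ _ := add_le_add e1 e2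
    _ = R := by
      simp only [LinearMap.comp_apply]
      rw [← add_mul, h1, one_mul]

theorem IsQuotientBy.eq_zero_of_states {K : ∀ n : ℕ, Set (MState A n)}
    {f : A.carrier →ₗ[ℂ] W.carrier} (hq : IsQuotientBy A K W f) {b : W.carrier}
    (hb : ∀ μ ∈ CS W 1, μ b 0 0 = 0) : b = 0 := by
  obtain ⟨a, rfl⟩ := hq.surj b
  have h := (hq.ker 1 (Matrix.of fun _ _ => a)).2 fun r ψ hψ => by
    rw [hq.image] at hψ
    obtain ⟨χ, hχ, rfl⟩ := hψ
    ext p q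
    have := norm_matrixState_apply_le (R := 0) (fun μ hμ => by rw [hb μ hμ, norm_zero]) hχ p.2 q.2
    rw [mul_zero, norm_le_zero_iff] at this
    exact this
  exact congrFun (congrFun h 0) 0

theorem prod_eq_zero_of_states (hA : ∀ b : A.carrier, (∀ μ ∈ CS A 1, μ b 0 0 = 0) → b = 0)
    (hB : ∀ b : B.carrier, (∀ μ ∈ CS B 1, μ b 0 0 = 0) → b = 0) {p : (A.prod B).carrier}
    (hp : ∀ μ ∈ CS (A.prod B) 1, μ p 0 0 = 0) : p = 0 :=
  Prod.ext (hA _ fun _ hμ => hp _ ((isUCP_fstL A B).comp_mem_CS hμ))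
    (hB _ fun _ hμ => hp _ ((isUCP_sndL A B).comp_mem_CS hμ))

end Products

section Bridge

variable {A W₁ W₂ : MOUS} {L : ∀ n : ℕ, Matrix (Fin n) (Fin n) A.carrier → ℝ}
  {X : Set (MState A 1)} {φ₁ : A.carrier →ₗ[ℂ] W₁.carrier} {φ₂ : A.carrier →ₗ[ℂ] W₂.carrier}
  {ε : ℝ}

/-- The seminorm on `V ⊕ V` which is bounded by `1` on pairs of Lipschitz elements at distance at
most `ε` over `X`. -/
def pairSeminorm (A : MOUS) (L : ∀ n : ℕ, Matrix (Fin n) (Fin n) A.carrier → ℝ)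
    (X : Set (MState A 1)) (ε : ℝ) (n : ℕ) (v : Matrix (Fin n) (Fin n) (A.prod A).carrier) : ℝ :=
  max (max (L n (mapMat (fstL A A) v)) (L n (mapMat (sndL A A) v)))
    (ε⁻¹ * stateSeminorm A X n (mapMat (fstL A A - sndL A A) v))

/-- The map `V ⊕ V → W₁ ⊕ W₂` with components `φ₁` and `φ₂`. -/
def prodMapL (φ₁ : A.carrier →ₗ[ℂ] W₁.carrier) (φ₂ : A.carrier →ₗ[ℂ] W₂.carrier) :
    (A.prod A).carrier →ₗ[ℂ] (W₁.prod W₂).carrier :=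
  LinearMap.prodMap φ₁ φ₂

/-- The diagonal map `V → V ⊕ V`. -/
def diagL (A : MOUS) : A.carrier →ₗ[ℂ] (A.prod A).carrier :=
  LinearMap.prod LinearMap.id LinearMap.id

/-- The seminorm on `W₁ ⊕ W₂` induced by `pairSeminorm`. -/
def bridgeSeminorm (L : ∀ n : ℕ, Matrix (Fin n) (Fin n) A.carrier → ℝ) (X : Set (MState A 1))
    (φ₁ : A.carrier →ₗ[ℂ] W₁.carrier) (φ₂ : A.carrier →ₗ[ℂ] W₂.carrier) (ε : ℝ) :
    ∀ n : ℕ, Matrix (Fin n) (Fin n) (W₁.prod W₂).carrier → ℝ :=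
  quotSeminorm (A.prod A) (W₁.prod W₂) (prodMapL φ₁ φ₂) (pairSeminorm A L X ε)

theorem prodMapL_surjective (h₁ : Function.Surjective φ₁) (h₂ : Function.Surjective φ₂) :
    Function.Surjective (prodMapL φ₁ φ₂) :=
  Function.Surjective.prodMap h₁ h₂

theorem isMatrixSeminorm_pairSeminorm (hL : IsMatrixSeminorm A L) (hX : X ⊆ CS A 1)
    (hε : 0 < ε) : IsMatrixSeminorm (A.prod A) (pairSeminorm A L X ε) :=
  ((hL.comap _).sup (hL.comap _)).sup
    (((isMatrixSeminorm_stateSeminorm hX).comap _).const_mul (inv_nonneg.2 hε.le))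

theorem isMatrixSeminorm_bridgeSeminorm (hL : IsMatrixSeminorm A L) (hX : X ⊆ CS A 1)
    (hε : 0 < ε) (h₁ : Function.Surjective φ₁) (h₂ : Function.Surjective φ₂) :
    IsMatrixSeminorm (W₁.prod W₂) (bridgeSeminorm L X φ₁ φ₂ ε) :=
  (isMatrixSeminorm_pairSeminorm hL hX hε).quotient (prodMapL_surjective h₁ h₂)

theorem pairSeminorm_conjTranspose (hL : ∀ n v, L n (Matrix.conjTranspose v) = L n v)
    (hX : X ⊆ CS A 1) {n : ℕ} (v : Matrix (Fin n) (Fin n) (A.prod A).carrier) :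
    pairSeminorm A L X ε n v.conjTranspose = pairSeminorm A L X ε n v := by
  unfold pairSeminorm
  rw [mapMat_conjTranspose (fstL A A) (fun _ => rfl), mapMat_conjTranspose (sndL A A)
    (fun _ => rfl), mapMat_conjTranspose (fstL A A - sndL A A) (fun _ => (star_sub _ _).symm),
    hL, hL, stateSeminorm_conjTranspose hX]

theorem bridgeSeminorm_conjTranspose (hL : IsMatrixLipschitzSeminorm A L)
    (hX : X ⊆ CS A 1) (hε : 0 < ε) (hφ₁ : IsUCP A W₁ φ₁) (hφ₂ : IsUCP A W₂ φ₂)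
    (h₁ : Function.Surjective φ₁) (h₂ : Function.Surjective φ₂) {n : ℕ}
    (v : Matrix (Fin n) (Fin n) (W₁.prod W₂).carrier) :
    bridgeSeminorm L X φ₁ φ₂ ε n v.conjTranspose = bridgeSeminorm L X φ₁ φ₂ ε n v :=
  quotSeminorm_conjTranspose (isMatrixSeminorm_pairSeminorm hL.isMatrixSeminorm hX hε).nonneg
    (fun _ v => pairSeminorm_conjTranspose hL.star_eq hX v) (prodMapL_surjective h₁ h₂)
    (fun a => Prod.ext (hφ₁.map_star a.1) (hφ₂.map_star a.2)) v

theorem pairSeminorm_diagL (hL : IsMatrixSeminorm A L) (hX : X ⊆ CS A 1) {n : ℕ}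
    (a : Matrix (Fin n) (Fin n) A.carrier) :
    pairSeminorm A L X ε n (mapMat (diagL A) a) = L n a := by
  have e : mapMat (fstL A A - sndL A A) (mapMat (diagL A) a) = 0 := by
    ext i j; exact sub_self _
  unfold pairSeminorm
  rw [e, (isMatrixSeminorm_stateSeminorm hX).map_zero, mul_zero]
  exact (max_eq_left (le_max_of_le_left (hL.nonneg _ _))).trans (max_self _)

theorem bridgeSeminorm_diagL_le (hL : IsMatrixSeminorm A L) (hX : X ⊆ CS A 1) (hε : 0 < ε)
    {n : ℕ} (a : Matrix (Fin n) (Fin n) A.carrier) :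
    bridgeSeminorm L X φ₁ φ₂ ε n (mapMat (prodMapL φ₁ φ₂) (mapMat (diagL A) a)) ≤ L n a :=
  (quotSeminorm_mapMat_le (isMatrixSeminorm_pairSeminorm hL hX hε).nonneg _ _).trans_eq
    (pairSeminorm_diagL hL hX a)

theorem exists_lift_of_bridgeSeminorm_lt (hε : 0 < ε) (h₁ : Function.Surjective φ₁)
    (h₂ : Function.Surjective φ₂) {n : ℕ} {b : Matrix (Fin n) (Fin n) (W₁.prod W₂).carrier} {c : ℝ}
    (h : bridgeSeminorm L X φ₁ φ₂ ε n b < c) :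
    ∃ a₁ a₂ : Matrix (Fin n) (Fin n) A.carrier, mapMat φ₁ a₁ = mapMat (fstL W₁ W₂) b ∧
      mapMat φ₂ a₂ = mapMat (sndL W₁ W₂) b ∧ L n a₁ < c ∧ L n a₂ < c ∧
      stateSeminorm A X n (a₁ - a₂) < ε * c := by
  obtain ⟨v, rfl, hv⟩ := exists_lt_of_quotSeminorm_lt (prodMapL_surjective h₁ h₂) h
  obtain ⟨hv12, hv3⟩ := max_lt_iff.1 hv
  obtain ⟨hv1, hv2⟩ := max_lt_iff.1 hv12
  exact ⟨_, _, rfl, rfl, hv1, hv2, by rwa [inv_mul_lt_iff₀ hε] at hv3⟩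

theorem totallyBoundedOnStates_bridgeSeminorm (hL : IsMatrixLipNorm A L) (hX : X ⊆ CS A 1)
    (hcpt : @IsCompact _ (lmTop A 1) X) (hε : 0 < ε)
    (h₁ : Function.Surjective φ₁) (h₂ : Function.Surjective φ₂)
    (hX₁ : ∀ χ ∈ CS W₁ 1, χ.comp φ₁ ∈ X) (hX₂ : ∀ χ ∈ CS W₂ 1, χ.comp φ₂ ∈ X) :
    TotallyBoundedOnStates (W₁.prod W₂) (bridgeSeminorm L X φ₁ φ₂ ε) := by
  intro δ hδ
  obtain ⟨F, hF, hFX⟩ := hL.exists_finite_pair_net hX hcpt hδ (ε * 2)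
  refine ⟨prodMapL φ₁ φ₂ '' F, hF.image _, fun p hp => ?_⟩
  obtain ⟨a₁, a₂, e₁, e₂, ha₁, ha₂, ha⟩ :=
    exists_lift_of_bridgeSeminorm_lt hε h₁ h₂ (hp.trans_lt one_lt_two)
  have hof : ∀ a : Matrix (Fin 1) (Fin 1) A.carrier, (Matrix.of fun _ _ => a 0 0) = a := fun a => by
    ext i j; rw [Subsingleton.elim i 0, Subsingleton.elim j 0]; rfl
  obtain ⟨f, hf, c, hc⟩ := hFX (a₁ 0 0, a₂ 0 0) (by rw [hof]; exact ha₁.le)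
    (by rw [hof]; exact ha₂.le)
    fun μ hμ => (norm_apply_le_stateSeminorm hX hμ (a := a₁ - a₂)).trans ha.le
  refine ⟨prodMapL φ₁ φ₂ f, ⟨f, hf, rfl⟩, c, fun μ hμ => ?_⟩
  have e₁' : φ₁ (a₁ 0 0) = (p 0 0).1 := congrFun (congrFun e₁ 0) 0
  have e₂' : φ₂ (a₂ 0 0) = (p 0 0).2 := congrFun (congrFun e₂ 0) 0
  have key := norm_prod_state_apply_le
    (b := p 0 0 - prodMapL φ₁ φ₂ f - c • (W₁.prod W₂).one) (R := δ) (fun χ hχ => ?_)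
    (fun χ hχ => ?_) hμ
  · rw [map_sub, Matrix.sub_apply, map_smul, Matrix.smul_apply,
      MState.apply_one_of_mem_CS hμ, smul_eq_mul, mul_one] at key
    exact key
  · show ‖χ ((p 0 0).1 - φ₁ f.1 - c • W₁.one) 0 0‖ ≤ δ
    have := (hc _ (hX₁ χ hχ)).1
    rw [← e₁', ← map_sub, map_sub, Matrix.sub_apply, map_smul, Matrix.smul_apply,
      MState.apply_one_of_mem_CS hχ, smul_eq_mul, mul_one]
    exact this
  · show ‖χ ((p 0 0).2 - φ₂ f.2 - c • W₂.one) 0 0‖ ≤ δ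
    have := (hc _ (hX₂ χ hχ)).2
    rw [← e₂', ← map_sub, map_sub, Matrix.sub_apply, map_smul, Matrix.smul_apply,
      MState.apply_one_of_mem_CS hχ, smul_eq_mul, mul_one]
    exact this

theorem bridgeSeminorm_scalar (hL : IsMatrixLipschitzSeminorm A L) (hX : X ⊆ CS A 1) (hε : 0 < ε)
    (hφ₁ : IsUCP A W₁ φ₁) (hφ₂ : IsUCP A W₂ φ₂) {n : ℕ} (lam : Matrix (Fin n) (Fin n) ℂ) :
    bridgeSeminorm L X φ₁ φ₂ ε n (Matrix.of fun i j => lam i j • (W₁.prod W₂).one) = 0 := by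
  refine le_antisymm ?_ (quotSeminorm_nonneg
    (isMatrixSeminorm_pairSeminorm hL.isMatrixSeminorm hX hε).nonneg _ _)
  have h := bridgeSeminorm_diagL_le (φ₁ := φ₁) (φ₂ := φ₂) hL.isMatrixSeminorm hX hε
    (Matrix.of fun i j => lam i j • A.one)
  rw [(hL.null_iff n _).2 ⟨lam, rfl⟩] at h
  refine le_trans (le_of_eq (congrArg (bridgeSeminorm L X φ₁ φ₂ ε n) ?_)) h
  ext i j : 2
  exact Prod.ext ((congrArg _ hφ₁.unital.symm).trans (map_smul φ₁ _ _).symm)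
    ((congrArg _ hφ₂.unital.symm).trans (map_smul φ₂ _ _).symm)

theorem induces_bridgeSeminorm (hL : IsMatrixSeminorm A L) (hX : X ⊆ CS A 1) (hε : 0 < ε)
    {Q : MOUS}
    {f : A.carrier →ₗ[ℂ] Q.carrier} {LQ : ∀ n : ℕ, Matrix (Fin n) (Fin n) Q.carrier → ℝ}
    (hLQ : Induces A Q f L LQ) {π : (W₁.prod W₂).carrier →ₗ[ℂ] Q.carrier}
    (hπ : ∀ a, π (prodMapL φ₁ φ₂ (diagL A a)) = f a)
    (hlift : ∀ (n : ℕ) (b : Matrix (Fin n) (Fin n) (W₁.prod W₂).carrier) (c : ℝ),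
      bridgeSeminorm L X φ₁ φ₂ ε n b < c → ∃ a, mapMat f a = mapMat π b ∧ L n a < c)
    (hf : Function.Surjective f) :
    Induces (W₁.prod W₂) Q π (bridgeSeminorm L X φ₁ φ₂ ε) LQ := by
  intro n b
  rw [hLQ]
  have hdiag : ∀ a : Matrix (Fin n) (Fin n) A.carrier,
      mapMat π (mapMat (prodMapL φ₁ φ₂) (mapMat (diagL A) a)) = mapMat f a := fun a => by
    ext i j; exact hπ _
  obtain ⟨a₀, ha₀⟩ := mapMat_surjective f hf n b
  refine le_antisymm (le_csInf ⟨_, _, (hdiag a₀).trans ha₀, rfl⟩ ?_)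
    (le_csInf ⟨_, a₀, ha₀, rfl⟩ ?_)
  · rintro _ ⟨p, rfl, rfl⟩
    refine le_of_forall_gt_imp_ge_of_dense fun c hc => ?_
    obtain ⟨a, ha, hac⟩ := hlift n p c hc
    rw [← ha]
    exact (quotSeminorm_mapMat_le hL.nonneg f a).trans hac.le
  · rintro _ ⟨a, rfl, rfl⟩
    rw [← hdiag]
    exact (quotSeminorm_mapMat_le (fun _ => quotSeminorm_nonneg
      (isMatrixSeminorm_pairSeminorm hL hX hε).nonneg _) π _).trans
      (bridgeSeminorm_diagL_le hL hX hε a)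

end Bridge

section Hausdorff

theorem sInf_image_le {σ : Type*} {T : Set σ} {g : σ → ℝ} {B : ℝ} (hB0 : 0 ≤ B)
    (hg : ∀ y ∈ T, 0 ≤ g y) (hB : ∀ y ∈ T, g y ≤ B) : sInf (g '' T) ≤ B := by
  rcases T.eq_empty_or_nonempty with rfl | ⟨y, hy⟩
  · simpa using hB0
  · exact le_trans (csInf_le ⟨0, by rintro _ ⟨y, hy, rfl⟩; exact hg y hy⟩ ⟨y, hy, rfl⟩) (hB y hy)

theorem sSup_sInf_le_add {σ τ : Type*} {S : Set σ} {T : Set τ} {d d' : σ → τ → ℝ} {B c : ℝ}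
    (hB0 : 0 ≤ B) (hc : 0 ≤ c) (hd : ∀ x ∈ S, ∀ y ∈ T, 0 ≤ d x y)
    (hd' : ∀ x ∈ S, ∀ y ∈ T, 0 ≤ d' x y) (hB : ∀ x ∈ S, ∀ y ∈ T, d' x y ≤ B)
    (h : ∀ x ∈ S, ∀ y ∈ T, d x y ≤ d' x y + c) :
    sSup ((fun x => sInf (d x '' T)) '' S) ≤ sSup ((fun x => sInf (d' x '' T)) '' S) + c := by
  have hnn : ∀ x ∈ S, 0 ≤ sInf (d' x '' T) := fun x hx =>
    Real.sInf_nonneg (by rintro _ ⟨y, hy, rfl⟩; exact hd' x hx y hy)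
  refine Real.sSup_le ?_ (add_nonneg (Real.sSup_nonneg
    (by rintro _ ⟨x, hx, rfl⟩; exact hnn x hx)) hc)
  rintro _ ⟨x, hx, rfl⟩
  have hle : sInf (d' x '' T) ≤ sSup ((fun x => sInf (d' x '' T)) '' S) := by
    refine le_csSup ⟨B, ?_⟩ ⟨x, hx, rfl⟩
    rintro _ ⟨x, hx, rfl⟩
    exact sInf_image_le hB0 (hd' x hx) (hB x hx)
  refine le_trans ?_ (add_le_add_left hle c)
  rcases T.eq_empty_or_nonempty with rfl | hT
  · simpa using hc
  rw [← sub_le_iff_le_add]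
  refine le_csInf (hT.image _) ?_
  rintro _ ⟨y, hy, rfl⟩
  rw [sub_le_iff_le_add]
  exact le_trans (csInf_le ⟨0, by rintro _ ⟨y, hy, rfl⟩; exact hd x hx y hy⟩ ⟨y, hy, rfl⟩)
    (h x hx y hy)

theorem hDist_image_le_add {X Y σ τ : Type} {d : X → X → ℝ} {d' : Y → Y → ℝ} {S : Set σ}
    {T : Set τ} {f₁ : σ → X} {f₂ : τ → X} {g₁ : σ → Y} {g₂ : τ → Y} {B c : ℝ}
    (hB0 : 0 ≤ B) (hc : 0 ≤ c) (hd : ∀ x y, 0 ≤ d x y) (hd' : ∀ x y, 0 ≤ d' x y)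
    (hB : ∀ x ∈ S, ∀ y ∈ T, d' (g₁ x) (g₂ y) ≤ B)
    (h : ∀ x ∈ S, ∀ y ∈ T, d (f₁ x) (f₂ y) ≤ d' (g₁ x) (g₂ y) + c) :
    hDist d (f₁ '' S) (f₂ '' T) ≤ hDist d' (g₁ '' S) (g₂ '' T) + c := by
  simp only [hDist, Set.image_image]
  rw [← max_add_add_right]
  exact max_le_max
    (sSup_sInf_le_add (d := fun x y => d (f₁ x) (f₂ y)) (d' := fun x y => d' (g₁ x) (g₂ y)) hB0 hc
      (fun _ _ _ _ => hd _ _) (fun _ _ _ _ => hd' _ _) hB h)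
    (sSup_sInf_le_add (d := fun y x => d (f₁ x) (f₂ y)) (d' := fun y x => d' (g₁ x) (g₂ y)) hB0 hc
      (fun _ _ _ _ => hd _ _) (fun _ _ _ _ => hd' _ _) (fun y hy x hx => hB x hx y hy)
      (fun y hy x hx => h x hx y hy))

theorem hDist_nonneg {X : Type} {d : X → X → ℝ} (hd : ∀ x y, 0 ≤ d x y) (s t : Set X) :
    0 ≤ hDist d s t :=
  le_max_of_le_left (Real.sSup_nonneg (by
    rintro _ ⟨x, -, rfl⟩
    exact Real.sInf_nonneg (by rintro _ ⟨y, -, rfl⟩; exact hd x y)))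

theorem hDist_le {X : Type} {d : X → X → ℝ} {s t : Set X} {B : ℝ} (hB0 : 0 ≤ B)
    (hd : ∀ x y, 0 ≤ d x y) (hB : ∀ x ∈ s, ∀ y ∈ t, d x y ≤ B) : hDist d s t ≤ B := by
  refine max_le (Real.sSup_le ?_ hB0) (Real.sSup_le ?_ hB0)
  · rintro _ ⟨x, hx, rfl⟩
    exact sInf_image_le hB0 (fun _ _ => hd _ _) (hB x hx)
  · rintro _ ⟨y, hy, rfl⟩
    exact sInf_image_le hB0 (fun _ _ => hd _ _) fun x hx => hB x hx y hy

end Hausdorff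

section BridgeDistance

variable {A W₁ W₂ : MOUS} {L : ∀ n : ℕ, Matrix (Fin n) (Fin n) A.carrier → ℝ}
  {X : Set (MState A 1)} {φ₁ : A.carrier →ₗ[ℂ] W₁.carrier} {φ₂ : A.carrier →ₗ[ℂ] W₂.carrier}
  {ε : ℝ}

theorem scalarOpNorm_mpair_le_stateSeminorm (hX : X ⊆ CS A 1)
    (hX₂ : ∀ χ ∈ CS W₂ 1, χ.comp φ₂ ∈ X) {n : ℕ} {χ : MState W₂ n} (hχ : χ ∈ CS W₂ n) {r : ℕ}
    (a : Matrix (Fin r) (Fin r) A.carrier) :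
    scalarOpNorm (mpair (χ.comp φ₂ : MState A n) a) ≤ (n : ℝ) ^ 2 * (2 * stateSeminorm A X r a) := by
  refine scalarOpNorm_mpair_le fun α β hα hβ i j => ?_
  refine norm_matrixState_apply_le (b := φ₂ (mmulMat α a β 0 0)) (fun μ hμ => ?_) hχ i j
  exact (norm_apply_le_stateSeminorm hX (hX₂ μ hμ) (a := mmulMat α a β)).trans
    ((isMatrixSeminorm_stateSeminorm hX).mmul_le_one le_rfl hα hβ)

theorem Dmet_bridgeSeminorm_le (hL : IsMatrixLipNorm A L) (hX : X ⊆ CS A 1) (hε : 0 < ε)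
    (hφ₁ : IsUCP A W₁ φ₁) (hφ₂ : IsUCP A W₂ φ₂)
    (h₁ : Function.Surjective φ₁) (h₂ : Function.Surjective φ₂)
    (hX₂ : ∀ χ ∈ CS W₂ 1, χ.comp φ₂ ∈ X) {n : ℕ} {χ₁ : MState W₁ n} {χ₂ : MState W₂ n}
    (hχ₁ : χ₁ ∈ CS W₁ n) (hχ₂ : χ₂ ∈ CS W₂ n) :
    Dmet (W₁.prod W₂) (bridgeSeminorm L X φ₁ φ₂ ε) n (χ₁.comp (fstL W₁ W₂))
      (χ₂.comp (sndL W₁ W₂)) ≤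
    Dmet A L n (χ₁.comp φ₁) (χ₂.comp φ₂) + (n : ℝ) ^ 2 * (2 * ε) := by
  set D := Dmet A L n (χ₁.comp φ₁) (χ₂.comp φ₂) with hD
  have hc : 0 ≤ D + (n : ℝ) ^ 2 * (2 * ε) := add_nonneg (Dmet_nonneg _ _) (by positivity)
  refine Dmet_le hc fun r p hp => ?_
  rw [← mul_one (D + _)]
  refine le_mul_of_forall_pos_add hc fun δ hδ => ?_
  obtain ⟨a₁, a₂, e₁, e₂, ha₁, -, ha⟩ :=
    exists_lift_of_bridgeSeminorm_lt hε h₁ h₂ (hp.trans_lt (lt_add_of_pos_right 1 hδ))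
  have e : mpair (χ₁.comp (fstL W₁ W₂) : MState (W₁.prod W₂) n) p -
      mpair (χ₂.comp (sndL W₁ W₂) : MState (W₁.prod W₂) n) p =
      (mpair (χ₁.comp φ₁ : MState A n) a₁ - mpair (χ₂.comp φ₂ : MState A n) a₁) +
        mpair (χ₂.comp φ₂ : MState A n) (a₁ - a₂) := by
    rw [mpair_comp, mpair_comp, ← e₁, ← e₂, mpair_comp, mpair_comp, mpair_comp, mapMat_sub]
    ext x y
    simp [mpair]
  rw [e]
  refine (scalarOpNorm_add_le _ _).trans ?_
  have hb := hL.DmetSet_bddAbove (hφ₁.comp_mem_CS hχ₁) (hφ₂.comp_mem_CS hχ₂)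
  have h3 := le_mul_Dmet hL.isMatrixSeminorm hb (by positivity : (0 : ℝ) < 1 + δ) ha₁.le
  have h4 := scalarOpNorm_mpair_le_stateSeminorm hX hX₂ hχ₂ (a₁ - a₂)
  have h5 : (n : ℝ) ^ 2 * (2 * stateSeminorm A X r (a₁ - a₂)) ≤
      (n : ℝ) ^ 2 * (2 * (ε * (1 + δ))) := by gcongr
  calc _ ≤ (1 + δ) * D + (n : ℝ) ^ 2 * (2 * (ε * (1 + δ))) := add_le_add h3 (h4.trans h5)
    _ = _ := by ring

theorem Dmet_le_of_bridgeSeminorm_radius (hL : IsMatrixLipNorm A L) (hX : X ⊆ CS A 1) (hε : 0 < ε)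
    (h₁ : Function.Surjective φ₁) (h₂ : Function.Surjective φ₂) {R : ℝ} (hR0 : 0 ≤ R)
    (hR : ∀ p : Matrix (Fin 1) (Fin 1) (W₁.prod W₂).carrier, bridgeSeminorm L X φ₁ φ₂ ε 1 p ≤ 1 →
      ∃ c : ℂ, ∀ μ ∈ CS (W₁.prod W₂) 1, ‖μ (p 0 0) 0 0 - c‖ ≤ R)
    {n : ℕ} {χ₁ : MState W₁ n} {χ₂ : MState W₂ n} (hχ₁ : χ₁ ∈ CS W₁ n) (hχ₂ : χ₂ ∈ CS W₂ n) :
    Dmet A L n (χ₁.comp φ₁) (χ₂.comp φ₂) ≤ (n : ℝ) ^ 2 * (4 * R) := by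
  refine Dmet_le (by positivity) fun r a ha => ?_
  have e₁ : mpair (χ₁.comp φ₁ : MState A n) a =
      mpair (χ₁.comp (fstL W₁ W₂) : MState (W₁.prod W₂) n)
        (mapMat (prodMapL φ₁ φ₂) (mapMat (diagL A) a)) := rfl
  have e₂ : mpair (χ₂.comp φ₂ : MState A n) a =
      mpair (χ₂.comp (sndL W₁ W₂) : MState (W₁.prod W₂) n)
        (mapMat (prodMapL φ₁ φ₂) (mapMat (diagL A) a)) := rfl
  rw [e₁, e₂]
  exact scalarOpNorm_mpair_sub_le_of_radius
    (isMatrixSeminorm_bridgeSeminorm hL.isMatrixSeminorm hX hε h₁ h₂) hR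
    ((isUCP_fstL W₁ W₂).comp_mem_CS hχ₁) ((isUCP_sndL W₁ W₂).comp_mem_CS hχ₂)
    ((bridgeSeminorm_diagL_le hL.isMatrixSeminorm hX hε a).trans ha)

theorem bridgeSeminorm_mem_MSet (hL : IsMatrixLipNorm A L) (hX : X ⊆ CS A 1)
    (hcpt : @IsCompact _ (lmTop A 1) X) (hε : 0 < ε) {K₁ K₂ : ∀ n : ℕ, Set (MState A n)}
    (hq₁ : IsQuotientBy A K₁ W₁ φ₁) (hq₂ : IsQuotientBy A K₂ W₂ φ₂)
    (hX₁ : ∀ χ ∈ CS W₁ 1, χ.comp φ₁ ∈ X) (hX₂ : ∀ χ ∈ CS W₂ 1, χ.comp φ₂ ∈ X)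
    {L₁ : ∀ n : ℕ, Matrix (Fin n) (Fin n) W₁.carrier → ℝ}
    {L₂ : ∀ n : ℕ, Matrix (Fin n) (Fin n) W₂.carrier → ℝ}
    (hL₁ : Induces A W₁ φ₁ L L₁) (hL₂ : Induces A W₂ φ₂ L L₂) :
    bridgeSeminorm L X φ₁ φ₂ ε ∈ MSet W₁ L₁ W₂ L₂ := by
  have hLs := hL.isMatrixSeminorm
  refine ⟨(totallyBoundedOnStates_bridgeSeminorm hL hX hcpt hε hq₁.surj hq₂.surj hX₁
    hX₂).isMatrixLipNorm (isMatrixSeminorm_bridgeSeminorm hLs hX hε hq₁.surj hq₂.surj)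
    (fun _ v => bridgeSeminorm_conjTranspose hL.toIsMatrixLipschitzSeminorm hX hε hq₁.ucp hq₂.ucp
      hq₁.surj hq₂.surj v)
    (fun _ lam => bridgeSeminorm_scalar hL.toIsMatrixLipschitzSeminorm hX hε hq₁.ucp hq₂.ucp lam)
    (fun p => prod_eq_zero_of_states (fun _ => hq₁.eq_zero_of_states)
      (fun _ => hq₂.eq_zero_of_states)), ?_, ?_⟩
  · refine induces_bridgeSeminorm hLs hX hε hL₁ (fun _ => rfl) (fun n b c hc => ?_) hq₁.surj
    obtain ⟨a₁, a₂, e₁, -, ha₁, -⟩ := exists_lift_of_bridgeSeminorm_lt hε hq₁.surj hq₂.surj hc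
    exact ⟨a₁, e₁, ha₁⟩
  · refine induces_bridgeSeminorm hLs hX hε hL₂ (fun _ => rfl) (fun n b c hc => ?_) hq₂.surj
    obtain ⟨a₁, a₂, -, e₂, -, ha₂, -⟩ := exists_lift_of_bridgeSeminorm_lt hε hq₁.surj hq₂.surj hc
    exact ⟨a₂, e₂, ha₂⟩

end BridgeDistance

/-- Proposition 4.8 of the paper.  Let `(V, L)` be a quantized metric
space and let `K⁽¹⁾`, `K⁽²⁾` be compact matrix convex subsets of `CS(V)`.  If
`(V_j, L_j)` is the quotient space of `(V, L)` with respect to `K⁽ʲ⁾` and the restriction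
map `φ⁽ʲ⁾` (`j = 1, 2`), then
`dist_NC(V₁, V₂) ≤ sup_k k⁻² dist_H^{D_{L_k}}(K⁽¹⁾_k, K⁽²⁾_k)`. -/
theorem distNC_quotients_le (A : MOUS)
    (L : ∀ n : ℕ, Matrix (Fin n) (Fin n) A.carrier → ℝ)
    (hL : IsMatrixLipNorm A L)
    (K₁ K₂ : ∀ n : ℕ, Set (MState A n))
    (hK₁ : IsMatrixConvexSubset A K₁) (hK₂ : IsMatrixConvexSubset A K₂)
    (hcpt₁ : ∀ n, @IsCompact _ (lmTop A n) (K₁ n))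
    (hcpt₂ : ∀ n, @IsCompact _ (lmTop A n) (K₂ n))
    (W₁ W₂ : MOUS)
    (φ₁ : A.carrier →ₗ[ℂ] W₁.carrier) (φ₂ : A.carrier →ₗ[ℂ] W₂.carrier)
    (hq₁ : IsQuotientBy A K₁ W₁ φ₁) (hq₂ : IsQuotientBy A K₂ W₂ φ₂)
    (L₁ : ∀ n : ℕ, Matrix (Fin n) (Fin n) W₁.carrier → ℝ)
    (L₂ : ∀ n : ℕ, Matrix (Fin n) (Fin n) W₂.carrier → ℝ)
    (hL₁ : Induces A W₁ φ₁ L L₁) (hL₂ : Induces A W₂ φ₂ L L₂) :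
    distNC W₁ L₁ W₂ L₂ ≤
      ⨆ k : ℕ, ((k : ℝ) ^ 2)⁻¹ * hDist (Dmet A L k) (K₁ k) (K₂ k) := by
  let X : Set (MState A 1) := K₁ 1 ∪ K₂ 1
  have hX : X ⊆ CS A 1 := Set.union_subset (hK₁.1 1) (hK₂.1 1)
  have hcpt : @IsCompact _ (lmTop A 1) X := @IsCompact.union _ (lmTop A 1) _ _ (hcpt₁ 1) (hcpt₂ 1)
  have hX₁ : ∀ χ ∈ CS W₁ 1, χ.comp φ₁ ∈ X := fun χ hχ =>
    Or.inl (by rw [hq₁.image]; exact ⟨χ, hχ, rfl⟩)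
  have hX₂ : ∀ χ ∈ CS W₂ 1, χ.comp φ₂ ∈ X := fun χ hχ =>
    Or.inr (by rw [hq₂.image]; exact ⟨χ, hχ, rfl⟩)
  obtain ⟨R, hR0, hR⟩ := (totallyBoundedOnStates_bridgeSeminorm hL hX hcpt one_pos hq₁.surj
    hq₂.surj hX₁ hX₂).exists_radius
  have hDR : ∀ n, ∀ χ₁ ∈ CS W₁ n, ∀ χ₂ ∈ CS W₂ n,
      Dmet A L n (χ₁.comp φ₁) (χ₂.comp φ₂) ≤ (n : ℝ) ^ 2 * (4 * R) := fun n χ₁ hχ₁ χ₂ hχ₂ =>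
    Dmet_le_of_bridgeSeminorm_radius hL hX one_pos hq₁.surj hq₂.surj hR0 hR hχ₁ hχ₂
  have hinv : ∀ n : ℕ, ∀ c : ℝ, 0 ≤ c → ((n : ℝ) ^ 2)⁻¹ * ((n : ℝ) ^ 2 * c) ≤ c := fun n c hc => by
    rw [← mul_assoc]
    exact mul_le_of_le_one_left hc (inv_mul_le_one)
  have hbdd : BddAbove (Set.range fun k : ℕ =>
      ((k : ℝ) ^ 2)⁻¹ * hDist (Dmet A L k) (K₁ k) (K₂ k)) := by
    refine ⟨4 * R, ?_⟩
    rintro _ ⟨n, rfl⟩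
    refine le_trans (mul_le_mul_of_nonneg_left ?_ (by positivity)) (hinv n (4 * R) (by positivity))
    refine hDist_le (by positivity) Dmet_nonneg ?_
    rw [hq₁.image, hq₂.image]
    rintro _ ⟨χ₁, hχ₁, rfl⟩ _ ⟨χ₂, hχ₂, rfl⟩
    exact hDR n χ₁ hχ₁ χ₂ hχ₂
  refine le_of_forall_pos_le_add fun η hη => ?_
  set ε := η / 2 with hε'
  have hε : 0 < ε := by positivity
  unfold distNC
  refine le_trans (csInf_le ⟨0, ?_⟩ ⟨_, bridgeSeminorm_mem_MSet hL hX hcpt hε hq₁ hq₂ hX₁ hX₂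
    hL₁ hL₂, rfl⟩) (ciSup_le fun n => ?_)
  · rintro _ ⟨N, -, rfl⟩
    exact Real.iSup_nonneg fun n => mul_nonneg (by positivity) (hDist_nonneg Dmet_nonneg _ _)
  · have h1 : hDist (Dmet (W₁.prod W₂) (bridgeSeminorm L X φ₁ φ₂ ε) n)
        ((fun φ : MState W₁ n => φ.comp (fstL W₁ W₂)) '' CS W₁ n)
        ((fun φ : MState W₂ n => φ.comp (sndL W₁ W₂)) '' CS W₂ n) ≤
        hDist (Dmet A L n) (K₁ n) (K₂ n) + (n : ℝ) ^ 2 * (2 * ε) := by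
      rw [hq₁.image, hq₂.image]
      exact hDist_image_le_add (by positivity : 0 ≤ (n : ℝ) ^ 2 * (4 * R)) (by positivity)
        Dmet_nonneg Dmet_nonneg (hDR n) fun χ₁ hχ₁ χ₂ hχ₂ =>
          Dmet_bridgeSeminorm_le hL hX hε hq₁.ucp hq₂.ucp hq₁.surj hq₂.surj hX₂ hχ₁ hχ₂
    refine (mul_le_mul_of_nonneg_left h1 (by positivity)).trans ?_
    rw [mul_add]
    refine add_le_add (le_ciSup hbdd n) ((hinv n _ (by positivity)).trans_eq ?_)
    rw [hε']; ring

end
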